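/- For any integer $r\ge 1$ and any $\alpha>0$, there exists $n_0$ such that for all $n\ge n_0$ divisible by $r+1$ the following holds. Let $G_1,\dots,G_m$ with $m=\binom{r+1}{2}\cdot\frac{n}{r+1}$ be graphs on $[n]$, each with minimum degree at least $(\frac{r}{r+1}+\alpha)n$. Then there exist $\frac{n}{r+1}$ vertex-disjoint copies of $K_{r+1}$ covering $[n]$ and a bijection $\phi$ from the edges of these cliques to $[m]$ such that each edge $e$ satisfies $e\in E(G_{\phi(e)})$. -/

import Mathlib

open scoped Classical

namespace RainbowFactor

/-- Greedy shift argument: few bad pairs leave an injective choice avoiding them. -/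
lemma exists_inj_avoid {α β : Type*} (K : Finset α) (C : Finset β) (bad : α → β → Prop)
    (hKC : K.card ≤ C.card)
    (hbad : ((K ×ˢ C).filter (fun p => bad p.1 p.2)).card < C.card) :
    ∃ γ : α → β, (∀ x ∈ K, γ x ∈ C ∧ ¬ bad x (γ x)) ∧ Set.InjOn γ (K : Set α) := by
  have hN : C.card ≠ 0 := by omega
  have : NeZero C.card := ⟨hN⟩
  have e : C ≃ ZMod C.card := Fintype.equivOfCardEq (by simp [ZMod.card])
  obtain ⟨i⟩ : Nonempty (K ↪ ZMod C.card) := by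
    apply Function.Embedding.nonempty_of_card_le
    simpa [ZMod.card] using hKC
  obtain ⟨c0, hc0⟩ : C.Nonempty := Finset.card_pos.mp (by omega)
  let e' : β → ZMod C.card := fun c => if h : c ∈ C then e ⟨c, h⟩ else 0
  let i' : α → ZMod C.card := fun x => if h : x ∈ K then i ⟨x, h⟩ else 0
  have hlt : (((K ×ˢ C).filter (fun p => bad p.1 p.2)).image
      (fun p => e' p.2 - i' p.1)).card < (Finset.univ : Finset (ZMod C.card)).card := by
    rw [Finset.card_univ, ZMod.card]
    exact lt_of_le_of_lt Finset.card_image_le hbad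
  obtain ⟨s, -, hs⟩ := Finset.exists_mem_notMem_of_card_lt_card hlt
  refine ⟨fun x => (e.symm (i' x + s) : C), ?_, ?_⟩
  · intro x hx
    refine ⟨(e.symm (i' x + s)).2, fun hb => hs ?_⟩
    rw [Finset.mem_image]
    refine ⟨(x, (e.symm (i' x + s) : C)), ?_, ?_⟩
    · rw [Finset.mem_filter, Finset.mem_product]
      exact ⟨⟨hx, (e.symm (i' x + s)).2⟩, hb⟩
    · simp [e']
  · intro x hx y hy hxy
    have h1 : e.symm (i' x + s) = e.symm (i' y + s) := Subtype.ext hxy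
    have h2 := e.symm.injective h1
    have h3 : i' x = i' y := by simpa using h2
    have hx' : x ∈ K := hx
    have hy' : y ∈ K := hy
    simp only [i', hx', hy', dif_pos] at h3
    have := i.injective h3
    simpa using this

section Search

variable {V κ : Type} [Fintype V]

/-- The class of label `l`. -/
noncomputable def cls (part : V → V) (l : V) : Finset V := Finset.univ.filter (fun u => part u = l)

lemma mem_cls {part : V → V} {l u : V} : u ∈ cls part l ↔ part u = l := by simp [cls]

/-- A partition of the vertices into rainbow cliques of size at most `r+1`. -/
def Valid (r : ℕ) (G : κ → SimpleGraph V) (part : V → V) (ψ : V → V → κ) : Prop :=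
  (∀ l, (cls part l).card ≤ r + 1) ∧
  (∀ u v, u ≠ v → part u = part v → (G (ψ u v)).Adj u v ∧ ψ u v = ψ v u) ∧
  (∀ u v u' v', u ≠ v → part u = part v → u' ≠ v' → part u' = part v' → ψ u v = ψ u' v' →
    (u = u' ∧ v = v') ∨ (u = v' ∧ v = u'))

noncomputable def Used (part : V → V) (ψ : V → V → κ) : Finset κ :=
  ((Finset.univ : Finset (V × V)).filter (fun p => p.1 ≠ p.2 ∧ part p.1 = part p.2)).image
    (fun p => ψ p.1 p.2)

lemma mem_Used {part : V → V} {ψ : V → V → κ} {c : κ} :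
    c ∈ Used part ψ ↔ ∃ u v, u ≠ v ∧ part u = part v ∧ ψ u v = c := by
  simp [Used, and_assoc]

noncomputable def pot (part : V → V) : ℕ := ∑ l, (cls part l).card ^ 2

lemma cls_update_self {part : V → V} {v l : V} :
    cls (Function.update part v l) l = insert v (cls part l) := by
  ext u
  simp only [mem_cls, Finset.mem_insert, Function.update_apply]
  split_ifs with h <;> simp [h]

lemma cls_update_old {part : V → V} {v l : V} (h : part v ≠ l) :
    cls (Function.update part v l) (part v) = (cls part (part v)).erase v := by
  ext u
  simp only [mem_cls, Finset.mem_erase, Function.update_apply]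
  split_ifs with h' <;> simp [h', h.symm]

lemma cls_update_other {part : V → V} {v l k : V} (h : k ≠ part v) (h2 : k ≠ l) :
    cls (Function.update part v l) k = cls part k := by
  ext u
  simp only [mem_cls, Function.update_apply]
  split_ifs with h' 
  · subst h'; simp [h.symm, h2.symm]
  · rfl

lemma pot_update {part : V → V} {v l : V} (h : part v ≠ l) :
    pot (Function.update part v l) + 2 * (cls part (part v)).card
      = pot part + 2 * (cls part l).card + 2 := by
  unfold pot
  have hm : l ∈ (Finset.univ : Finset V) := Finset.mem_univ _
  have hm2 : part v ∈ (Finset.univ : Finset V).erase l := by simp [h]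
  rw [← Finset.add_sum_erase _ _ hm, ← Finset.add_sum_erase _ _ hm2,
    ← Finset.add_sum_erase _ (fun l => (cls part l).card ^ 2) hm,
    ← Finset.add_sum_erase _ (fun l => (cls part l).card ^ 2) hm2]
  have e1 : ∑ x ∈ (Finset.univ.erase l).erase (part v),
      (cls (Function.update part v l) x).card ^ 2
      = ∑ x ∈ (Finset.univ.erase l).erase (part v), (cls part x).card ^ 2 := by
    apply Finset.sum_congr rfl
    intro x hx
    simp only [Finset.mem_erase] at hx
    rw [cls_update_other hx.1 hx.2.1]
  rw [e1, cls_update_self, cls_update_old h, Finset.card_insert_of_notMem (by simpa [mem_cls] using h)]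
  have hv : v ∈ cls part (part v) := by simp [mem_cls]
  have hp : (cls part (part v)).card = ((cls part (part v)).erase v).card + 1 := by
    rw [Finset.card_erase_add_one hv]
  rw [hp]
  ring

lemma move {r : ℕ} {G : κ → SimpleGraph V} {part : V → V} {ψ : V → V → κ}
    (hval : Valid r G part ψ) (v l : V) (hl : part v ≠ l) (hcard : (cls part l).card ≤ r)
    (γ : V → κ) (hadj : ∀ y ∈ cls part l, (G (γ y)).Adj v y)
    (hinj : Set.InjOn γ (cls part l : Set V))
    (hun : ∀ y ∈ cls part l, γ y ∉ Used part ψ) :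
    ∃ ψ', Valid r G (Function.update part v l) ψ' ∧
      Used (Function.update part v l) ψ' ⊆ Used part ψ ∪ (cls part l).image γ := by
  obtain ⟨h1, h2, h3⟩ := hval
  have hadj' : ∀ y, part y = l → (G (γ y)).Adj v y := fun y hy => hadj y (mem_cls.2 hy)
  have hinj' : ∀ y z, part y = l → part z = l → γ y = γ z → y = z := fun y z hy hz h =>
    hinj (by simpa [mem_cls] using hy) (by simpa [mem_cls] using hz) h
  have hun' : ∀ y u w, part y = l → u ≠ w → part u = part w → ψ u w ≠ γ y := by
    intro y u w hy huw hp h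
    exact hun y (mem_cls.2 hy) (mem_Used.2 ⟨u, w, huw, hp, h⟩)
  refine ⟨fun x y => if x = v then γ y else if y = v then γ x else ψ x y, ⟨?_, ?_, ?_⟩, ?_⟩
  · intro k
    by_cases hk : k = l
    · subst hk
      rw [cls_update_self]
      exact (Finset.card_insert_le _ _).trans (by omega)
    · by_cases hk2 : k = part v
      · subst hk2
        rw [cls_update_old hl]
        exact (Finset.card_erase_le).trans (h1 _)
      · rw [cls_update_other hk2 hk]; exact h1 _
  · intro x y hxy hp
    simp only [Function.update_apply] at hp
    by_cases hx : x = v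
    · have hy : ¬ y = v := fun h => hxy (hx.trans h.symm)
      simp only [hx, hy, if_true, if_false] at hp ⊢
      exact ⟨hadj' y hp.symm, trivial⟩
    · by_cases hy : y = v
      · simp only [hx, hy, if_true, if_false] at hp ⊢
        exact ⟨(hadj' x hp).symm, trivial⟩
      · simp only [hx, hy, if_false] at hp ⊢
        exact h2 x y hxy hp
  · intro x y x' y' hxy hp hxy' hp' he
    simp only [Function.update_apply] at hp hp' he
    split_ifs at hp hp' he <;> grind
  · intro c hc
    rw [mem_Used] at hc
    obtain ⟨x, y, hxy, hp, he⟩ := hc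
    rw [Finset.mem_union, mem_Used, Finset.mem_image]
    simp only [Function.update_apply, mem_cls] at hp he ⊢
    split_ifs at hp he with a b
    · exact absurd (a.trans b.symm) hxy
    · exact Or.inr ⟨y, hp.symm, he⟩
    · exact Or.inr ⟨x, hp, he⟩
    · exact Or.inl ⟨x, y, hxy, hp, he⟩

end Search
end RainbowFactor

namespace RainbowFactor
section Search2
variable {V κ : Type} [Fintype V]

lemma two_mul_used_le {r : ℕ} {G : κ → SimpleGraph V} {part : V → V} {ψ : V → V → κ}
    (hval : Valid r G part ψ) :
    2 * (Used part ψ).card + (Finset.univ.filter (fun v => (cls part (part v)).card ≤ r)).card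
      ≤ r * Fintype.card V := by
  obtain ⟨h1, h2, h3⟩ := hval
  have hA : 2 * (Used part ψ).card ≤ ((Finset.univ : Finset (V × V)).filter
      (fun p => p.1 ≠ p.2 ∧ part p.1 = part p.2)).card := by
    apply Finset.mul_card_image_le_card
    intro c hc
    simp only [Finset.mem_image, Finset.mem_filter, Finset.mem_univ, true_and, Prod.exists] at hc
    obtain ⟨u, v, ⟨huv, hp⟩, he⟩ := hc
    have : ({(u, v), (v, u)} : Finset (V × V)).card = 2 := by
      apply Finset.card_pair
      simp [huv]
    rw [← this]
    apply Finset.card_le_card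
    intro p hp'
    simp only [Finset.mem_insert, Finset.mem_singleton] at hp'
    rw [Finset.mem_filter, Finset.mem_filter]
    rcases hp' with rfl | rfl
    · exact ⟨⟨Finset.mem_univ _, huv, hp⟩, he⟩
    · exact ⟨⟨Finset.mem_univ _, huv.symm, hp.symm⟩, by rw [← he]; exact ((h2 u v huv hp).2).symm⟩
  have hB : ((Finset.univ : Finset (V × V)).filter
      (fun p => p.1 ≠ p.2 ∧ part p.1 = part p.2)).card
      = ∑ u : V, (Finset.univ.filter (fun v => u ≠ v ∧ part u = part v)).card := by
    rw [Finset.card_filter, ← Finset.univ_product_univ, Finset.sum_product]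
    simp only [Finset.card_filter]
  have hC : (Finset.univ.filter (fun v => (cls part (part v)).card ≤ r)).card
      = ∑ u : V, if (cls part (part u)).card ≤ r then 1 else 0 := Finset.card_filter _ _
  have hD : ∑ u : V, ((Finset.univ.filter (fun v => u ≠ v ∧ part u = part v)).card +
      if (cls part (part u)).card ≤ r then 1 else 0) ≤ ∑ u : V, r := by
    apply Finset.sum_le_sum
    intro u _
    have e : (Finset.univ.filter (fun v => u ≠ v ∧ part u = part v)) =
        (cls part (part u)).erase u := by
      ext v; simp [mem_cls, eq_comm]
    have hm : u ∈ cls part (part u) := mem_cls.2 rfl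
    have hc := Finset.card_erase_add_one hm
    rw [e]
    have := h1 (part u)
    split_ifs <;> omega
  rw [Finset.sum_add_distrib, ← hB, ← hC] at hD
  simp only [Finset.sum_const, Finset.card_univ, smul_eq_mul] at hD
  rw [mul_comm (Fintype.card V)] at hD
  omega

/-- number of bad triples between a class, another class and a colour set -/
noncomputable def badc (G : κ → SimpleGraph V) (Q K : Finset V) (C : Finset κ) : ℕ :=
  ∑ v ∈ Q, ∑ x ∈ K, (C.filter (fun c => ¬ (G c).Adj v x)).card

lemma row {G : κ → SimpleGraph V} {Q K : Finset V} {C : Finset κ}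
    (hb : badc G Q K C < Q.card * K.card) (hK : K.card ≤ C.card) :
    ∃ v ∈ Q, ∃ γ : V → κ, (∀ x ∈ K, γ x ∈ C ∧ (G (γ x)).Adj v x) ∧ Set.InjOn γ (K : Set V) := by
  unfold badc at hb
  obtain ⟨v, hv, hlt⟩ : ∃ v ∈ Q, ∑ x ∈ K, (C.filter (fun c => ¬ (G c).Adj v x)).card < K.card := by
    by_contra hcon
    push Not at hcon
    have := Finset.card_nsmul_le_sum Q _ _ hcon
    rw [smul_eq_mul] at this
    omega
  obtain ⟨γ, h1, h2⟩ := exists_inj_avoid K C (fun x c => ¬ (G c).Adj v x) hK (by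
    rw [Finset.card_filter, Finset.sum_product]
    simp only [Finset.card_filter] at hlt
    refine lt_of_lt_of_le (lt_of_eq_of_lt ?_ hlt) hK
    congr!)
  exact ⟨v, hv, γ, fun x hx => ⟨(h1 x hx).1, not_not.1 (h1 x hx).2⟩, h2⟩

lemma badc_comm {G : κ → SimpleGraph V} {Q K : Finset V} {C : Finset κ} :
    badc G Q K C = badc G K Q C := by
  unfold badc
  rw [Finset.sum_comm]
  simp only [SimpleGraph.adj_comm]

lemma badc_total {G : κ → SimpleGraph V} (part : V → V) (Q : Finset V) (C : Finset κ) (D : ℕ)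
    (hD : ∀ c v, (Finset.univ.filter (fun u => ¬ (G c).Adj v u)).card ≤ D) :
    ∑ k, badc G Q (cls part k) C ≤ Q.card * (C.card * D) := by
  unfold badc
  rw [Finset.sum_comm]
  rw [← smul_eq_mul]
  apply Finset.sum_le_card_nsmul
  intro v _
  have : ∑ k, ∑ x ∈ cls part k, (C.filter (fun c => ¬ (G c).Adj v x)).card
      = ∑ x, (C.filter (fun c => ¬ (G c).Adj v x)).card := by
    unfold cls
    exact Finset.sum_fiberwise _ _ _
  rw [this]
  simp only [Finset.card_filter]
  rw [Finset.sum_comm, ← smul_eq_mul]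
  apply Finset.sum_le_card_nsmul
  intro c _
  rw [← Finset.card_filter]
  exact hD c v

lemma sum_cls (part : V → V) : ∑ k, (cls part k).card = Fintype.card V := by
  unfold cls
  rw [← Finset.card_univ, Finset.card_eq_sum_card_fiberwise (f := part) (t := Finset.univ) (by simp)]

/-- maximal states: structural consequence -/
lemma not_both {r q : ℕ} {G : κ → SimpleGraph V} {part : V → V} {ψ : V → V → κ}
    (hval : Valid r G part ψ)
    (hmax : ∀ part' ψ', Valid r G part' ψ' → pot part' ≤ pot part)
    (hq : q ≤ r) {L : ℕ} (Q : Fin L → V) (hQ : Function.Injective Q)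
    (hQc : ∀ i, (cls part (Q i)).card = q)
    (C : Fin L → Finset κ) (hC : ∀ i, (C i).card = r + 1)
    (hCd : ∀ i j, i ≠ j → Disjoint (C i) (C j)) (hCu : ∀ i, Disjoint (C i) (Used part ψ))
    (k : V) (i j : Fin L) (hij : i ≠ j)
    (hi : badc G (cls part (Q i)) (cls part k) (C i) < q * (cls part k).card)
    (hj : badc G (cls part (Q j)) (cls part k) (C j) < q * (cls part k).card) : False := by
  have hK := hval.1 k
  have hq0 : 0 < q := by
    rcases Nat.eq_zero_or_pos q with h | h
    · subst h; simp at hi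
    · exact h
  have hK0 : 0 < (cls part k).card := by
    rcases Nat.eq_zero_or_pos (cls part k).card with h | h
    · rw [h] at hi; simp at hi
    · exact h
  -- nonfull case
  have key : ∀ i, k ≠ Q i → badc G (cls part (Q i)) (cls part k) (C i) < q * (cls part k).card →
      (cls part k).card ≤ r → False := by
    intro i hki hi hkr
    rcases le_or_gt q (cls part k).card with hle | hlt
    · obtain ⟨v, hv, γ, h1, h2⟩ := row (by rwa [hQc]) (by rw [hC]; omega : (cls part k).card ≤ (C i).card)
      rw [mem_cls] at hv
      obtain ⟨ψ', hv', -⟩ := move hval v k (by rw [hv]; exact hki.symm) hkr γ (fun y hy => (h1 y hy).2) h2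
        (fun y hy => Finset.disjoint_left.1 (hCu i) (h1 y hy).1)
      have := hmax _ _ hv'
      have hp := pot_update (part := part) (v := v) (l := k) (by rw [hv]; exact hki.symm)
      rw [hv, hQc] at hp
      omega
    · rw [badc_comm] at hi
      obtain ⟨x, hx, γ, h1, h2⟩ := row (G := G) (Q := cls part k) (K := cls part (Q i)) (C := C i)
        (by rw [hQc, mul_comm]; exact hi)
        (by rw [hC, hQc]; omega : (cls part (Q i)).card ≤ (C i).card)
      rw [mem_cls] at hx
      obtain ⟨ψ', hv', -⟩ := move hval x (Q i) (by rw [hx]; exact hki) (by rw [hQc]; exact hq) γ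
        (fun y hy => (h1 y hy).2) h2
        (fun y hy => Finset.disjoint_left.1 (hCu i) (h1 y hy).1)
      have := hmax _ _ hv'
      have hp := pot_update (part := part) (v := x) (l := Q i) (by rw [hx]; exact hki)
      rw [hx, hQc] at hp
      omega
  rcases Nat.lt_or_ge r (cls part k).card with hfull | hnf
  · have hkc : (cls part k).card = r + 1 := by omega
    have hki : k ≠ Q i := by rintro rfl; rw [hQc] at hkc; omega
    have hkj : k ≠ Q j := by rintro rfl; rw [hQc] at hkc; omega
    have hQij : Q i ≠ Q j := fun h => hij (hQ h)
    rw [badc_comm] at hi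
    obtain ⟨x, hx, γ, h1, h2⟩ := row (G := G) (Q := cls part k) (K := cls part (Q i)) (C := C i)
        (by rw [hQc, mul_comm]; exact hi)
      (by rw [hC, hQc]; omega : (cls part (Q i)).card ≤ (C i).card)
    rw [mem_cls] at hx
    have hxi : part x ≠ Q i := by rw [hx]; exact hki
    obtain ⟨ψ', hv', hU⟩ := move hval x (Q i) hxi (by rw [hQc]; exact hq) γ
      (fun y hy => (h1 y hy).2) h2
      (fun y hy => Finset.disjoint_left.1 (hCu i) (h1 y hy).1)
    have hp := pot_update (part := part) (v := x) (l := Q i) hxi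
    rw [hx, hQc, hkc] at hp
    obtain ⟨v, hv, γ', h1', h2'⟩ := row (by rwa [hQc]) (by rw [hC]; omega : (cls part k).card ≤ (C j).card)
    rw [mem_cls] at hv
    have hvx : v ≠ x := by rintro rfl; exact hkj (hx.symm.trans hv)
    set part2 := Function.update part x (Q i) with hpart2
    have hv2 : part2 v = Q j := by rw [hpart2, Function.update_of_ne hvx, hv]
    have hck : cls part2 k = (cls part k).erase x := by
      rw [hpart2, ← hx, cls_update_old hxi]
    have hcj : cls part2 (Q j) = cls part (Q j) :=
      cls_update_other (by rw [hx]; exact hkj.symm) hQij.symm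
    have hck' : (cls part2 k).card = r := by
      rw [hck, Finset.card_erase_of_mem (mem_cls.2 hx), hkc]; rfl
    have hsub : ∀ y, y ∈ cls part2 k → y ∈ cls part k := by
      intro y hy; rw [hck] at hy; exact Finset.mem_of_mem_erase hy
    have hne : part2 v ≠ k := by rw [hv2]; exact hkj.symm
    obtain ⟨ψ'', hv'', -⟩ := move hv' v k hne hck'.le γ'
      (fun y hy => (h1' y (hsub y hy)).2) (h2'.mono (fun y hy => hsub y hy))
      (by
        intro y hy hmem
        have hyC := (h1' y (hsub y hy)).1
        rcases Finset.mem_union.1 (hU hmem) with h | h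
        · exact Finset.disjoint_left.1 (hCu j) hyC h
        · obtain ⟨z, hz, hze⟩ := Finset.mem_image.1 h
          exact Finset.disjoint_left.1 (hCd i j hij) (hze ▸ (h1 z hz).1) hyC)
    have hp2 := pot_update (part := part2) (v := v) (l := k) hne
    rw [hv2, hcj, hQc, hck'] at hp2
    have := hmax _ _ hv''
    omega
  · by_cases hki : k = Q i
    · exact key j (fun h => hij (hQ (hki.symm.trans h))) hj hnf
    · exact key i hki hi hnf

/-- Local search: a rainbow clique partition with boundedly many non-full vertices. -/
lemma search (r : ℕ) (δ : ℝ) (hδ : 0 < δ) : ∃ W : ℕ,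
    ∀ (V κ : Type) [Fintype V] [Fintype κ] (G : κ → SimpleGraph V),
      2 * Fintype.card κ = r * Fintype.card V →
      (∀ c v, ((r : ℝ) + 1) * ((Finset.univ.filter (fun u => ¬ (G c).Adj v u)).card : ℝ)
        ≤ (1 - δ) * Fintype.card V) →
      1 ≤ r →
      ∃ part ψ, Valid r G part ψ ∧
        (Finset.univ.filter (fun v => (cls part (part v)).card ≤ r)).card ≤ W := by
  obtain ⟨L, hL⟩ := exists_nat_gt (1 / δ)
  refine ⟨2 * L * (r + 1) + (r + 1) * (r * L), ?_⟩
  intro V κ _ _ G hcard hdeg hr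
  have hne : Nonempty (V → V → κ) := by
    rcases isEmpty_or_nonempty V with h | h
    · exact ⟨fun v => (h.false v).elim⟩
    · have : 0 < Fintype.card V := Fintype.card_pos
      have : 0 < Fintype.card κ := by nlinarith
      have := Fintype.card_pos_iff.1 this
      exact ⟨fun _ _ => Classical.choice this⟩
  obtain ⟨ψ0⟩ := hne
  have hstart : Valid r G id ψ0 := by
    refine ⟨?_, ?_, ?_⟩
    · intro l
      have : cls id l = {l} := by ext u; simp [mem_cls]
      rw [this]; simp
    · intro u v h h'; exact absurd h' h
    · intro u v _ _ h h'; exact absurd h' h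
  obtain ⟨⟨part, ψ⟩, hst, hmax⟩ := Finset.exists_max_image
    ((Finset.univ : Finset ((V → V) × (V → V → κ))).filter (fun s => Valid r G s.1 s.2))
    (fun s => pot s.1) ⟨(id, ψ0), by simp [hstart]⟩
  simp only [Finset.mem_filter, Finset.mem_univ, true_and, Prod.forall] at hst hmax
  refine ⟨part, ψ, hst, ?_⟩
  by_contra hcon
  push Not at hcon
  set N := Finset.univ.filter (fun v => (cls part (part v)).card ≤ r) with hN
  have hused := two_mul_used_le hst
  rw [← hN, ← hcard] at hused
  -- pick q
  obtain ⟨q, hqm, hq⟩ := Finset.exists_lt_card_fiber_of_mul_lt_card_of_maps_to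
    (s := N) (t := Finset.range (r + 1)) (f := fun v => (cls part (part v)).card) (n := r * L)
    (by intro v hv; simp only [hN, Finset.mem_filter] at hv; simp; omega)
    (by rw [Finset.card_range]; omega)
  have hqr : q ≤ r := by simp at hqm; omega
  set Nq := N.filter (fun v => (cls part (part v)).card = q) with hNq
  have himg : L ≤ (Nq.image part).card := by
    have : Nq.card ≤ r * (Nq.image part).card := by
      apply Finset.card_le_mul_card_image
      intro l hl
      obtain ⟨v, hv, rfl⟩ := Finset.mem_image.1 hl
      have hv2 : (cls part (part v)).card = q := (Finset.mem_filter.1 hv).2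
      calc _ ≤ (cls part (part v)).card := Finset.card_le_card (by
              intro u hu; exact mem_cls.2 (Finset.mem_filter.1 hu).2)
        _ ≤ r := by omega
    have h2 : r * L ≤ r * (Nq.image part).card := by omega
    exact Nat.le_of_mul_le_mul_left h2 (by omega)
  obtain ⟨eQ⟩ : Nonempty (Fin L ↪ (Nq.image part)) := by
    apply Function.Embedding.nonempty_of_card_le; rw [Fintype.card_fin, Fintype.card_coe]; exact himg
  have hunc : L * (r + 1) ≤ ((Used part ψ)ᶜ).card := by
    rw [Finset.card_compl]
    have : 2 * (L * (r + 1)) = 2 * L * (r + 1) := by ring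
    omega
  obtain ⟨eC⟩ : Nonempty ((Fin L × Fin (r + 1)) ↪ ((Used part ψ)ᶜ : Finset κ)) := by
    apply Function.Embedding.nonempty_of_card_le
    rw [Fintype.card_prod, Fintype.card_fin, Fintype.card_fin, Fintype.card_coe]
    exact hunc
  let Q : Fin L → V := fun i => (eQ i : V)
  have hQ : Function.Injective Q := fun i j h => eQ.injective (Subtype.ext h)
  have hQc : ∀ i, (cls part (Q i)).card = q := by
    intro i
    obtain ⟨v, hv, hvi⟩ := Finset.mem_image.1 (eQ i).2
    have hv2 : (cls part (part v)).card = q := (Finset.mem_filter.1 hv).2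
    rw [← hv2, hvi]
  let C : Fin L → Finset κ := fun i => Finset.univ.image (fun a : Fin (r + 1) => (eC (i, a) : κ))
  have hC : ∀ i, (C i).card = r + 1 := by
    intro i
    rw [Finset.card_image_of_injective]
    · simp
    · intro a b hab
      have := eC.injective (Subtype.ext hab)
      simpa using this
  have hCd : ∀ i j, i ≠ j → Disjoint (C i) (C j) := by
    intro i j hij
    rw [Finset.disjoint_left]
    intro c h1 h2
    simp only [C, Finset.mem_image, Finset.mem_univ, true_and] at h1 h2
    obtain ⟨a, ha⟩ := h1
    obtain ⟨b, hb⟩ := h2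
    have := eC.injective (Subtype.ext (ha.trans hb.symm))
    simp at this
    exact hij this.1
  have hCu : ∀ i, Disjoint (C i) (Used part ψ) := by
    intro i
    rw [Finset.disjoint_left]
    intro c h1 h2
    simp only [C, Finset.mem_image, Finset.mem_univ, true_and] at h1
    obtain ⟨a, ha⟩ := h1
    have := (eC (i, a)).2
    rw [ha, Finset.mem_compl] at this
    exact this h2
  have hbad := not_both hst hmax hqr Q hQ hQc C hC hCd hCu
  have hq0 : 0 < q := by
    obtain ⟨v, hv⟩ := Finset.card_pos.1 (lt_of_le_of_lt (Nat.zero_le _) hq)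
    rw [← (Finset.mem_filter.1 hv).2]
    exact Finset.card_pos.2 ⟨v, mem_cls.2 rfl⟩
  have hn0 : 0 < Fintype.card V := by
    obtain ⟨v, hv⟩ := Finset.card_pos.1 (lt_of_le_of_lt (Nat.zero_le _) hq)
    exact Fintype.card_pos_iff.2 ⟨v⟩
  -- lower bound
  have hlow : ∀ k, (L - 1) * (q * (cls part k).card)
      ≤ ∑ i, badc G (cls part (Q i)) (cls part k) (C i) := by
    intro k
    set B := (Finset.univ : Finset (Fin L)).filter
      (fun i => badc G (cls part (Q i)) (cls part k) (C i) < q * (cls part k).card) with hB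
    have hB1 : B.card ≤ 1 := by
      rw [Finset.card_le_one]
      intro i hi j hj
      by_contra hij
      exact hbad k i j hij (Finset.mem_filter.1 hi).2 (Finset.mem_filter.1 hj).2
    have hBc : L - 1 ≤ (Bᶜ).card := by
      rw [Finset.card_compl, Fintype.card_fin]; omega
    calc (L - 1) * (q * (cls part k).card) ≤ (Bᶜ).card * (q * (cls part k).card) :=
          Nat.mul_le_mul_right _ hBc
      _ ≤ ∑ i ∈ Bᶜ, badc G (cls part (Q i)) (cls part k) (C i) := by
          rw [← smul_eq_mul]
          apply Finset.card_nsmul_le_sum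
          intro i hi
          simp only [hB, Finset.mem_compl, Finset.mem_filter, Finset.mem_univ, true_and,
            not_lt] at hi
          exact hi
      _ ≤ _ := Finset.sum_le_sum_of_subset (Finset.subset_univ _)
  obtain ⟨⟨c, v⟩, -, hD⟩ := Finset.exists_max_image (Finset.univ : Finset (κ × V))
    (fun p => (Finset.univ.filter (fun u => ¬ (G p.1).Adj p.2 u)).card) (by
      have : Nonempty V := Fintype.card_pos_iff.1 hn0
      have : 0 < Fintype.card κ := by nlinarith
      have : Nonempty κ := Fintype.card_pos_iff.1 this
      exact Finset.univ_nonempty)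
  set D := (Finset.univ.filter (fun u => ¬ (G c).Adj v u)).card with hDdef
  have hDle := hdeg c v
  rw [← hDdef] at hDle
  have htot : (L - 1) * (q * Fintype.card V) ≤ L * (q * ((r + 1) * D)) := by
    calc (L - 1) * (q * Fintype.card V) = ∑ k, (L - 1) * (q * (cls part k).card) := by
          rw [← Finset.mul_sum, ← Finset.mul_sum, sum_cls]
      _ ≤ ∑ k, ∑ i, badc G (cls part (Q i)) (cls part k) (C i) :=
          Finset.sum_le_sum (fun k _ => hlow k)
      _ = ∑ i, ∑ k, badc G (cls part (Q i)) (cls part k) (C i) := Finset.sum_comm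
      _ ≤ ∑ i : Fin L, q * ((r + 1) * D) := by
          apply Finset.sum_le_sum
          intro i _
          have := badc_total (G := G) part (cls part (Q i)) (C i) D
            (fun c v => hD (c, v) (Finset.mem_univ _))
          rwa [hQc, hC] at this
      _ = _ := by simp
  have hL0 : 1 ≤ L := by
    have : (0 : ℝ) < L := lt_trans (by positivity) hL
    exact_mod_cast this
  have htotR : ((L : ℝ) - 1) * (q * Fintype.card V) ≤ L * (q * ((r + 1) * D)) := by
    have := (Nat.cast_le (α := ℝ)).2 htot
    push_cast [Nat.cast_sub hL0] at this
    exact this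
  have hLδ : 1 < L * δ := by
    rwa [div_lt_iff₀ hδ] at hL
  have hqn : (0 : ℝ) < q * Fintype.card V := by positivity
  have h5 : (L : ℝ) * (q * ((r + 1) * D)) ≤ L * (q * ((1 - δ) * Fintype.card V)) := by gcongr
  nlinarith
end Search2
end RainbowFactor

namespace RainbowFactor
section Tiles
variable {V κ : Type}

/-- Index set of the edges of a clique on `{0,…,r}`. -/
def E (r : ℕ) : Finset (ℕ × ℕ) :=
  (Finset.range (r + 1) ×ˢ Finset.range (r + 1)).filter (fun p => p.1 < p.2)

lemma mem_E {r : ℕ} {p : ℕ × ℕ} : p ∈ E r ↔ p.1 < p.2 ∧ p.2 ≤ r := by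
  simp only [E, Finset.mem_filter, Finset.mem_product, Finset.mem_range]
  omega

lemma card_E (r : ℕ) : (E r).card = (r + 1).choose 2 := by
  have h : (E r).card = ∑ j ∈ Finset.range (r + 1), j := by
    unfold E
    rw [Finset.card_filter, Finset.sum_product_right]
    apply Finset.sum_congr rfl
    intro j hj
    rw [← Finset.card_filter]
    have : (Finset.range (r + 1)).filter (fun x => x < j) = Finset.range j := by
      ext x; simp at hj ⊢; omega
    rw [this, Finset.card_range]
  rw [h, Finset.sum_range_id, Nat.choose_two_right]

lemma two_mul_card_E (r : ℕ) : 2 * (E r).card = r * (r + 1) := by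
  rw [card_E, Nat.choose_two_right, Nat.mul_div_cancel']
  · simp; ring
  · simpa [mul_comm] using (Nat.even_mul_succ_self r).two_dvd

noncomputable def vsum (s : Finset ℕ) (f : ℕ → V) : Multiset (V ⊕ κ) := ∑ i ∈ s, {Sum.inl (f i)}
noncomputable def csum (s : Finset (ℕ × ℕ)) (g : ℕ × ℕ → κ) : Multiset (V ⊕ κ) :=
  ∑ p ∈ s, {Sum.inr (g p)}

noncomputable def tile (r : ℕ) (f : ℕ → V) (g : ℕ × ℕ → κ) : Multiset (V ⊕ κ) :=
  vsum (Finset.range (r + 1)) f + csum (E r) g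

def IsTile (r : ℕ) (G : κ → SimpleGraph V) (X : Multiset (V ⊕ κ)) : Prop :=
  ∃ f g, (∀ p ∈ E r, (G (g p)).Adj (f p.1) (f p.2)) ∧ X = tile r f g

/-- The multisets that can be decomposed into tiles. -/
def Cl (r : ℕ) (G : κ → SimpleGraph V) : AddSubmonoid (Multiset (V ⊕ κ)) :=
  AddSubmonoid.closure {X | IsTile r G X}

lemma tile_mem {r : ℕ} {G : κ → SimpleGraph V} {f : ℕ → V} {g : ℕ × ℕ → κ}
    (h : ∀ p ∈ E r, (G (g p)).Adj (f p.1) (f p.2)) : tile r f g ∈ Cl r G :=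
  AddSubmonoid.subset_closure ⟨f, g, h, rfl⟩

/-- sequential averaging choice -/
lemma greedy {τ : Type} [Fintype V] (c : ℝ) (hc : 0 ≤ c)
    (A : ℕ → τ → (ℕ → V) → Finset V) (s0 : ℕ → V)
    (hloc : ∀ k t s s', (∀ j < k, s j = s' j) → A k t s = A k t s')
    (p : ℕ)
    (hA : ∀ k < p, ∀ t s, c * Fintype.card V ≤ (A k t s).card) (T : Finset τ) :
    ∃ (s : ℕ → V) (T' : Finset τ), T' ⊆ T ∧ c ^ p * T.card ≤ T'.card ∧
      ∀ t ∈ T', ∀ k < p, s k ∈ A k t s := by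
  induction p with
  | zero => exact ⟨s0, T, Finset.Subset.refl _, by simp, by simp⟩
  | succ p ih =>
    obtain ⟨s, T', hsub, hcard, hmem⟩ := ih (fun k hk => hA k (by omega))
    have hne : Nonempty V := ⟨s0 0⟩
    obtain ⟨w, hw⟩ : ∃ w : V, c * T'.card ≤ ((T'.filter (fun t => w ∈ A p t s)).card : ℝ) := by
      by_contra hcon
      push Not at hcon
      have h1 : ∑ w : V, ((T'.filter (fun t => w ∈ A p t s)).card : ℝ)
          = ∑ t ∈ T', ((A p t s).card : ℝ) := by
        simp only [Finset.card_filter]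
        push_cast
        rw [Finset.sum_comm]
        apply Finset.sum_congr rfl
        intro t _
        simp
      have h2 : ∑ w : V, ((T'.filter (fun t => w ∈ A p t s)).card : ℝ)
          < ∑ w : V, c * T'.card := Finset.sum_lt_sum_of_nonempty Finset.univ_nonempty
            (fun w _ => hcon w)
      have h3 : ∑ t ∈ T', (c * Fintype.card V) ≤ ∑ t ∈ T', ((A p t s).card : ℝ) :=
        Finset.sum_le_sum (fun t _ => hA p (by omega) t s)
      rw [h1] at h2
      simp only [Finset.sum_const, nsmul_eq_mul, Finset.card_univ] at h2 h3
      nlinarith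
    refine ⟨Function.update s p w, T'.filter (fun t => w ∈ A p t s),
      (Finset.filter_subset _ _).trans hsub, ?_, ?_⟩
    · calc c ^ (p + 1) * T.card = c * (c ^ p * T.card) := by ring
        _ ≤ c * T'.card := by gcongr
        _ ≤ _ := hw
    · intro t ht k hk
      rw [Finset.mem_filter] at ht
      have hl : A k t (Function.update s p w) = A k t s := by
        apply hloc
        intro j hj
        rw [Function.update_of_ne (by omega)]
      rw [hl]
      rcases Nat.lt_succ_iff_lt_or_eq.1 hk with h | h
      · rw [Function.update_of_ne (by omega)]; exact hmem t ht.1 k h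
      · subst h; rw [Function.update_self]; exact ht.2

/-- candidates satisfying a list of adjacency constraints -/
noncomputable def cand [Fintype V] (G : κ → SimpleGraph V) (F : Finset (V ⊕ κ))
    (l : List (V × κ)) : Finset V :=
  Finset.univ.filter (fun w => Sum.inl w ∉ F ∧ ∀ p ∈ l, (G p.2).Adj p.1 w)

lemma cand_card [Fintype V] (G : κ → SimpleGraph V) (F : Finset (V ⊕ κ)) (l : List (V × κ))
    (D : ℕ) (hD : ∀ c v, (Finset.univ.filter (fun u => ¬ (G c).Adj v u)).card ≤ D) :
    Fintype.card V ≤ (cand G F l).card + F.card + l.length * D := by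
  induction l with
  | nil =>
    have h : (Finset.univ : Finset V) ⊆ cand G F [] ∪ F.preimage Sum.inl Sum.inl_injective.injOn := by
      intro v _
      simp only [cand, Finset.mem_union, Finset.mem_filter, Finset.mem_preimage, Finset.mem_univ]
      by_cases h : Sum.inl v ∈ F <;> simp [h]
    have h1 := (Finset.card_le_card h).trans (Finset.card_union_le _ _)
    have h2 : (F.preimage (Sum.inl : V → V ⊕ κ) Sum.inl_injective.injOn).card ≤ F.card := by
      rw [← Finset.card_image_of_injective _ (Sum.inl_injective (α := V) (β := κ))]
      apply Finset.card_le_card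
      intro x hx
      simp only [Finset.mem_image, Finset.mem_preimage] at hx
      obtain ⟨a, ha, rfl⟩ := hx
      exact ha
    rw [Finset.card_univ] at h1
    simp only [List.length_nil, zero_mul]
    omega
  | cons p l ih =>
    have h : cand G F l ⊆ cand G F (p :: l) ∪ Finset.univ.filter (fun u => ¬ (G p.2).Adj p.1 u) := by
      intro v hv
      simp only [cand, Finset.mem_union, Finset.mem_filter, Finset.mem_univ, true_and,
        List.forall_mem_cons] at hv ⊢
      tauto
    have h1 := (Finset.card_le_card h).trans (Finset.card_union_le _ _)
    have h2 := hD p.2 p.1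
    rw [List.length_cons, Nat.add_mul]
    omega

/-- the degree condition, phrased by non-neighbours -/
def Deg [Fintype V] (r : ℕ) (δ : ℝ) (G : κ → SimpleGraph V) : Prop :=
  ∀ c v, ((r : ℝ) + 1) * ((Finset.univ.filter (fun u => ¬ (G c).Adj v u)).card : ℝ)
        ≤ (1 - δ) * Fintype.card V

lemma cand_card' [Fintype V] {r : ℕ} {δ : ℝ} {G : κ → SimpleGraph V} (h : Deg r δ G)
    (hδ : δ ≤ 1)
    (F : Finset (V ⊕ κ)) (hF : (F.card : ℝ) ≤ δ / 2 * Fintype.card V)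
    (l : List (V × κ)) (hl : l.length ≤ r + 1) :
    δ / 2 * Fintype.card V ≤ (cand G F l).card := by
  set D := ⌊(1 - δ) * Fintype.card V / (r + 1)⌋₊ with hD
  have h1 := cand_card G F l D (by
    intro c v
    apply Nat.le_floor
    rw [le_div_iff₀ (by positivity), mul_comm]
    exact h c v)
  have h2 : (D : ℝ) ≤ (1 - δ) * Fintype.card V / (r + 1) := by
    apply Nat.floor_le
    have : 0 ≤ 1 - δ := by linarith
    positivity
  rw [le_div_iff₀ (by positivity)] at h2
  have h3 : (Fintype.card V : ℝ) ≤ (cand G F l).card + F.card + l.length * D := by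
    exact_mod_cast h1
  have h4 : (l.length : ℝ) * D ≤ (r + 1) * D := by
    gcongr
    exact_mod_cast hl
  linarith

end Tiles
end RainbowFactor

namespace RainbowFactor
section Absorb
variable {V κ : Type}

lemma sum_singleton_eq {ι α : Type} (s : Finset ι) (h : ι → α) :
    ∑ i ∈ s, ({h i} : Multiset α) = s.val.map h := by
  induction s using Finset.induction_on with
  | empty => simp
  | insert a s ha ih => rw [Finset.sum_insert ha, ih, Finset.insert_val_of_notMem ha]; simp

lemma mem_vsum {s : Finset ℕ} {f : ℕ → V} {b : V ⊕ κ} :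
    b ∈ (vsum s f : Multiset (V ⊕ κ)) ↔ ∃ i ∈ s, Sum.inl (f i) = b := by
  unfold vsum; rw [sum_singleton_eq]; simp

lemma mem_csum {s : Finset (ℕ × ℕ)} {g : ℕ × ℕ → κ} {b : V ⊕ κ} :
    b ∈ (csum s g : Multiset (V ⊕ κ)) ↔ ∃ i ∈ s, Sum.inr (g i) = b := by
  unfold csum; rw [sum_singleton_eq]; simp

lemma card_vsum {s : Finset ℕ} {f : ℕ → V} :
    (vsum s f : Multiset (V ⊕ κ)).card = s.card := by
  unfold vsum; rw [sum_singleton_eq]; simp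

lemma card_csum {s : Finset (ℕ × ℕ)} {g : ℕ × ℕ → κ} :
    (csum s g : Multiset (V ⊕ κ)).card = s.card := by
  unfold csum; rw [sum_singleton_eq]; simp

lemma nodup_vc {s : Finset ℕ} {f : ℕ → V} {s' : Finset (ℕ × ℕ)} {g : ℕ × ℕ → κ}
    (hf : Set.InjOn f (s : Set ℕ)) (hg : Set.InjOn g (s' : Set (ℕ × ℕ))) :
    (vsum s f + csum s' g : Multiset (V ⊕ κ)).Nodup := by
  rw [Multiset.nodup_add]
  refine ⟨?_, ?_, ?_⟩
  · unfold vsum; rw [sum_singleton_eq]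
    exact Multiset.Nodup.map_on (fun x hx y hy h => hf hx hy (Sum.inl_injective h)) s.nodup
  · unfold csum; rw [sum_singleton_eq]
    exact Multiset.Nodup.map_on (fun x hx y hy h => hg hx hy (Sum.inr_injective h)) s'.nodup
  · rw [Multiset.disjoint_left]
    intro a ha hb
    rw [mem_vsum] at ha
    rw [mem_csum] at hb
    obtain ⟨i, -, rfl⟩ := ha
    obtain ⟨j, -, h⟩ := hb
    cases h

lemma exists_colours [Fintype κ] (r : ℕ) (F : Finset (V ⊕ κ))
    (hκ : F.card + (E r).card ≤ Fintype.card κ) (c0 : κ) :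
    ∃ g : ℕ × ℕ → κ, Set.InjOn g (E r : Set (ℕ × ℕ)) ∧ ∀ p ∈ E r, (Sum.inr (g p) : V ⊕ κ) ∉ F := by
  set F' := (Finset.univ : Finset κ).filter (fun c => (Sum.inr c : V ⊕ κ) ∉ F) with hF'
  have h2 : (Finset.univ.filter (fun c : κ => ¬ (Sum.inr c : V ⊕ κ) ∉ F)).card ≤ F.card := by
    rw [← Finset.card_image_of_injective _ (Sum.inr_injective (α := V) (β := κ))]
    apply Finset.card_le_card
    intro x hx
    simp only [Finset.mem_image, Finset.mem_filter, not_not] at hx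
    obtain ⟨a, ha, rfl⟩ := hx
    exact ha.2
  have h3 := Finset.card_filter_add_card_filter_not (s := (Finset.univ : Finset κ))
    (fun c => (Sum.inr c : V ⊕ κ) ∉ F)
  rw [Finset.card_univ] at h3
  have h4 : (E r).card ≤ F'.card := by rw [hF']; omega
  obtain ⟨e⟩ : Nonempty ((E r) ↪ F') := by
    apply Function.Embedding.nonempty_of_card_le
    rw [Fintype.card_coe, Fintype.card_coe]; exact h4
  refine ⟨fun p => if h : p ∈ E r then (e ⟨p, h⟩ : κ) else c0, ?_, ?_⟩
  · intro p hp q hq h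
    have hp' : p ∈ E r := hp
    have hq' : q ∈ E r := hq
    simp only [hp', hq', dif_pos] at h
    have := e.injective (Subtype.ext h)
    simpa using this
  · intro p hp
    simp only [hp, dif_pos]
    exact (Finset.mem_filter.1 (e ⟨p, hp⟩).2).2

lemma injOn_of_adj {G : κ → SimpleGraph V} {s : ℕ → V} {g : ℕ × ℕ → κ} {m : ℕ}
    (h : ∀ k < m, ∀ j < k, (G (g (j, k))).Adj (s j) (s k)) :
    Set.InjOn s (Finset.range m : Set ℕ) := by
  intro i hi j hj hij
  simp only [Finset.coe_range, Set.mem_Iio] at hi hj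
  rcases lt_trichotomy i j with hlt | he | hlt
  · exact absurd hij (h j hj i hlt).ne
  · exact he
  · exact absurd hij.symm (h i hi j hlt).ne

/-- `y` can be swapped with most of the `z t`, avoiding a small set. -/
def Swappable {τ : Type} (r : ℕ) (G : κ → SimpleGraph V) (m0 : ℕ) (c0 : ℝ) (b0 : ℕ)
    (y : V ⊕ κ) (z : τ → V ⊕ κ) : Prop :=
  ∀ F : Finset (V ⊕ κ), F.card ≤ m0 → ∀ T : Finset τ, T.Nonempty →
    ∃ (B : Multiset (V ⊕ κ)) (T' : Finset τ), T' ⊆ T ∧ c0 * T.card ≤ T'.card ∧ B.Nodup ∧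
      (∀ b ∈ B, b ∉ F) ∧ B.card ≤ b0 ∧ B + {y} ∈ Cl r G ∧ ∀ t ∈ T', B + {z t} ∈ Cl r G

lemma swap_sum {τ ι : Type} {r : ℕ} {G : κ → SimpleGraph V} {m0 : ℕ} {c0 : ℝ} (hc0 : 0 < c0)
    {b0 : ℕ} (y : ι → V ⊕ κ) (z : ι → τ → V ⊕ κ) (S : Finset ι)
    (hS : ∀ i ∈ S, Swappable r G m0 c0 b0 (y i) (z i))
    (F : Finset (V ⊕ κ)) (hF : F.card + S.card * b0 ≤ m0) (T : Finset τ) (hT : T.Nonempty) :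
    ∃ (B : Multiset (V ⊕ κ)) (T' : Finset τ), T' ⊆ T ∧ c0 ^ S.card * T.card ≤ T'.card ∧ B.Nodup ∧
      (∀ b ∈ B, b ∉ F) ∧ B.card ≤ S.card * b0 ∧ B + ∑ i ∈ S, {y i} ∈ Cl r G ∧
      ∀ t ∈ T', B + ∑ i ∈ S, {z i t} ∈ Cl r G := by
  induction S using Finset.induction_on with
  | empty =>
    exact ⟨0, T, Finset.Subset.refl _, by simp, by simp, by simp, by simp,
      by simp [zero_mem], by simp [zero_mem]⟩
  | insert i S hi ih =>
    rw [Finset.card_insert_of_notMem hi] at hF ⊢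
    rw [Nat.add_mul, one_mul] at hF ⊢
    obtain ⟨B, T', h1, h2, h3, h4, h5, h6, h7⟩ := ih
      (fun j hj => hS j (Finset.mem_insert_of_mem hj)) (by omega)
    have hT' : T'.Nonempty := by
      rw [← Finset.card_pos]
      have : (0 : ℝ) < T.card := by exact_mod_cast hT.card_pos
      have : (0 : ℝ) < T'.card := lt_of_lt_of_le (by positivity) h2
      exact_mod_cast this
    have hFB : (F ∪ B.toFinset).card ≤ m0 := by
      have := Finset.card_union_le F B.toFinset
      have := Multiset.toFinset_card_le B
      omega
    obtain ⟨B', T'', g1, g2, g3, g4, g5, g6, g7⟩ :=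
      hS i (Finset.mem_insert_self _ _) _ hFB T' hT'
    refine ⟨B + B', T'', g1.trans h1, ?_, ?_, ?_, ?_, ?_, ?_⟩
    · calc c0 ^ (S.card + 1) * T.card = c0 * (c0 ^ S.card * T.card) := by ring
        _ ≤ c0 * T'.card := by gcongr
        _ ≤ _ := g2
    · rw [Multiset.nodup_add]
      refine ⟨h3, g3, ?_⟩
      rw [Multiset.disjoint_left]
      intro b hb hb'
      exact g4 b hb' (by simp [hb])
    · intro b hb
      rcases Multiset.mem_add.1 hb with hb | hb
      · exact h4 b hb
      · intro hF'; exact g4 b hb (by simp [hF'])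
    · rw [Multiset.card_add]; omega
    · rw [Finset.sum_insert hi]
      have := add_mem h6 g6
      convert this using 1; abel
    · intro t ht
      rw [Finset.sum_insert hi]
      have := add_mem (h7 t (g1 ht)) (g7 t ht)
      convert this using 1; abel

variable [Fintype V] [Fintype κ]

lemma vswap {τ : Type} {r : ℕ} {δ : ℝ} {G : κ → SimpleGraph V} (h : Deg r δ G) (hδ0 : 0 < δ)
    (hδ : δ ≤ 1) (m0 : ℕ) (hm : (m0 : ℝ) ≤ δ / 2 * Fintype.card V)
    (hκ : m0 + (E r).card ≤ Fintype.card κ) (c1 : κ) (x : V) (z : τ → V) :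
    Swappable r G m0 ((δ / 2) ^ (r + 1)) (r + 1 + (E r).card) (Sum.inl x)
      (fun t => Sum.inl (z t)) := by
  intro F hF T hT
  have hFr : (F.card : ℝ) ≤ δ / 2 * Fintype.card V := le_trans (by exact_mod_cast hF) hm
  obtain ⟨g, hg1, hg2⟩ := exists_colours r F (by omega) c1
  obtain ⟨s, T', hsub, hcard, hmem⟩ := greedy (τ := τ) (δ / 2) (by positivity)
    (fun k t s => cand G F ((x, g (k, r)) :: (z t, g (k, r)) ::
      (List.range k).map (fun j => (s j, g (j, k))))) (fun _ => x)
    (by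
      intro k t s s' hs
      have : (List.range k).map (fun j => (s j, g (j, k))) =
          (List.range k).map (fun j => (s' j, g (j, k))) := by
        apply List.map_congr_left
        intro j hj
        rw [hs j (List.mem_range.1 hj)]
      simp only [this]) r
    (by
      intro k hk t s
      apply cand_card' h hδ F hFr
      simp; omega) T
  have hT'pos : (0 : ℝ) < T'.card := lt_of_lt_of_le (by
    have : (0 : ℝ) < T.card := by exact_mod_cast hT.card_pos
    positivity) hcard
  obtain ⟨t0, ht0⟩ : T'.Nonempty := Finset.card_pos.1 (by exact_mod_cast hT'pos)
  simp only [cand, Finset.mem_filter, Finset.mem_univ, true_and, List.forall_mem_cons,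
    List.forall_mem_map, List.mem_range] at hmem
  have hss : ∀ k < r, ∀ j < k, (G (g (j, k))).Adj (s j) (s k) :=
    fun k hk j hj => (hmem t0 ht0 k hk).2.2.2 j hj
  have htile : ∀ y, (∀ k < r, (G (g (k, r))).Adj y (s k)) →
      vsum (Finset.range r) s + csum (E r) g + {Sum.inl y} ∈ Cl r G := by
    intro y hy
    have : vsum (Finset.range r) s + csum (E r) g + {Sum.inl y} =
        tile r (fun i => if i < r then s i else y) g := by
      unfold tile vsum
      rw [Finset.sum_range_succ]
      have : ∑ i ∈ Finset.range r, ({Sum.inl (if i < r then s i else y)} : Multiset (V ⊕ κ))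
          = ∑ i ∈ Finset.range r, {Sum.inl (s i)} := by
        apply Finset.sum_congr rfl
        intro i hi
        rw [if_pos (Finset.mem_range.1 hi)]
      rw [this]
      simp only [lt_irrefl, if_false]
      abel
    rw [this]
    apply tile_mem
    rintro ⟨i, j⟩ hp
    rw [mem_E] at hp
    simp only at hp ⊢
    rw [if_pos (by omega)]
    rcases Nat.lt_or_ge j r with hj | hj
    · rw [if_pos hj]; exact hss j hj i hp.1
    · have : j = r := by omega
      subst this
      rw [if_neg (lt_irrefl _)]
      exact (hy i hp.1).symm
  refine ⟨vsum (Finset.range r) s + csum (E r) g, T', hsub, ?_, ?_, ?_, ?_, ?_, ?_⟩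
  · refine le_trans ?_ hcard
    have : (δ / 2) ^ (r + 1) ≤ (δ / 2) ^ r :=
      pow_le_pow_of_le_one (by positivity) (by linarith) (by omega)
    gcongr
  · exact nodup_vc (injOn_of_adj hss) hg1
  · intro b hb
    rw [Multiset.mem_add, mem_vsum, mem_csum] at hb
    rcases hb with ⟨i, hi, rfl⟩ | ⟨p, hp, rfl⟩
    · exact (hmem t0 ht0 i (Finset.mem_range.1 hi)).1
    · exact hg2 p hp
  · rw [Multiset.card_add, card_vsum, card_csum, Finset.card_range]; omega
  · exact htile x (fun k hk => (hmem t0 ht0 k hk).2.1)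
  · intro t ht
    exact htile (z t) (fun k hk => (hmem t ht k hk).2.2.1)

lemma cswap {τ : Type} {r : ℕ} (hr : 1 ≤ r) {δ : ℝ} {G : κ → SimpleGraph V} (h : Deg r δ G)
    (hδ0 : 0 < δ)
    (hδ : δ ≤ 1) (m0 : ℕ) (hm : (m0 : ℝ) ≤ δ / 2 * Fintype.card V)
    (hκ : m0 + (E r).card ≤ Fintype.card κ) (v0 : V) (d : κ) (z : τ → κ) :
    Swappable r G m0 ((δ / 2) ^ (r + 1)) (r + 1 + (E r).card) (Sum.inr d)
      (fun t => Sum.inr (z t)) := by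
  intro F hF T hT
  have hFr : (F.card : ℝ) ≤ δ / 2 * Fintype.card V := le_trans (by exact_mod_cast hF) hm
  obtain ⟨g, hg1, hg2⟩ := exists_colours r F (by omega) d
  obtain ⟨s, T', hsub, hcard, hmem⟩ := greedy (τ := τ) (δ / 2) (by positivity)
    (fun k t s => cand G F ((if k = 1 then [(s 0, z t)] else []) ++
      (List.range k).map (fun j => (s j, Function.update g (0, 1) d (j, k))))) (fun _ => v0)
    (by
      intro k t s s' hs
      have : (List.range k).map (fun j => (s j, Function.update g (0, 1) d (j, k))) =
          (List.range k).map (fun j => (s' j, Function.update g (0, 1) d (j, k))) := by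
        apply List.map_congr_left
        intro j hj
        rw [hs j (List.mem_range.1 hj)]
      simp only [this]
      by_cases hk : k = 1
      · rw [hs 0 (by omega)]
      · simp [hk]) (r + 1)
    (by
      intro k hk t s
      apply cand_card' h hδ F hFr
      by_cases hk1 : k = 1
      · subst hk1; simp; omega
      · simp [hk1]; omega) T
  have hT'pos : (0 : ℝ) < T'.card := lt_of_lt_of_le (by
    have : (0 : ℝ) < T.card := by exact_mod_cast hT.card_pos
    positivity) hcard
  obtain ⟨t0, ht0⟩ : T'.Nonempty := Finset.card_pos.1 (by exact_mod_cast hT'pos)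
  simp only [cand, Finset.mem_filter, Finset.mem_univ, true_and, List.forall_mem_append,
    List.forall_mem_map, List.mem_range] at hmem
  have hss : ∀ k < r + 1, ∀ j < k, (G (Function.update g (0, 1) d (j, k))).Adj (s j) (s k) :=
    fun k hk j hj => (hmem t0 ht0 k hk).2.2 j hj
  have h01 : ((0, 1) : ℕ × ℕ) ∈ E r := by rw [mem_E]; simp; omega
  have htile : ∀ y, (G y).Adj (s 0) (s 1) →
      vsum (Finset.range (r + 1)) s + csum ((E r).erase (0, 1)) g + {Sum.inr y} ∈ Cl r G := by
    intro y hy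
    have : vsum (Finset.range (r + 1)) s + csum ((E r).erase (0, 1)) g + {Sum.inr y} =
        tile r s (Function.update g (0, 1) y) := by
      unfold tile csum
      rw [← Finset.add_sum_erase _ _ h01]
      have : ∑ p ∈ (E r).erase (0, 1), ({Sum.inr (Function.update g (0, 1) y p)} : Multiset (V ⊕ κ))
          = ∑ p ∈ (E r).erase (0, 1), {Sum.inr (g p)} := by
        apply Finset.sum_congr rfl
        intro p hp
        rw [Function.update_of_ne (Finset.ne_of_mem_erase hp)]
      rw [this, Function.update_self]
      abel
    rw [this]
    apply tile_mem
    rintro ⟨i, j⟩ hp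
    rw [mem_E] at hp
    simp only at hp ⊢
    by_cases hij : (i, j) = ((0, 1) : ℕ × ℕ)
    · rw [hij, Function.update_self]
      simp only [Prod.mk.injEq] at hij
      rw [hij.1, hij.2]; exact hy
    · have := hss j (by omega) i hp.1
      rwa [Function.update_of_ne hij] at this ⊢
  refine ⟨vsum (Finset.range (r + 1)) s + csum ((E r).erase (0, 1)) g, T', hsub, hcard,
    ?_, ?_, ?_, ?_, ?_⟩
  · exact nodup_vc (injOn_of_adj hss) (hg1.mono (by
      intro p hp; exact Finset.mem_of_mem_erase hp))
  · intro b hb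
    rw [Multiset.mem_add, mem_vsum, mem_csum] at hb
    rcases hb with ⟨i, hi, rfl⟩ | ⟨p, hp, rfl⟩
    · exact (hmem t0 ht0 i (Finset.mem_range.1 hi)).1
    · exact hg2 p (Finset.mem_of_mem_erase hp)
  · rw [Multiset.card_add, card_vsum, card_csum, Finset.card_range]
    have := Finset.card_erase_le (s := E r) (a := (0, 1))
    omega
  · apply htile
    have := hss 1 (by omega) 0 (by omega)
    rwa [Function.update_self] at this
  · intro t ht
    apply htile
    have := (hmem t ht 1 (by omega)).2.1
    simpa using this

/-- A rainbow clique avoiding a small set. -/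
lemma exists_clique {r : ℕ} {δ : ℝ} {G : κ → SimpleGraph V} (h : Deg r δ G) (hδ0 : 0 < δ)
    (hδ : δ ≤ 1) (F : Finset (V ⊕ κ)) (hF : (F.card : ℝ) ≤ δ / 2 * Fintype.card V)
    (hκ : F.card + (E r).card ≤ Fintype.card κ) (v0 : V) (d : κ) :
    ∃ s g, tile r s g ∈ Cl r G ∧ (tile r s g).Nodup ∧ ∀ b ∈ tile r s g, b ∉ F := by
  obtain ⟨g, hg1, hg2⟩ := exists_colours r F hκ d
  obtain ⟨s, T', hsub, hcard, hmem⟩ := greedy (τ := Unit) (δ / 2) (by positivity)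
    (fun k t s => cand G F ((List.range k).map (fun j => (s j, g (j, k))))) (fun _ => v0)
    (by
      intro k t s s' hs
      have : (List.range k).map (fun j => (s j, g (j, k))) =
          (List.range k).map (fun j => (s' j, g (j, k))) := by
        apply List.map_congr_left
        intro j hj
        rw [hs j (List.mem_range.1 hj)]
      simp only [this]) (r + 1)
    (by
      intro k hk t s
      apply cand_card' h hδ F hF
      simp; omega) {()}
  have hT'pos : (0 : ℝ) < T'.card := lt_of_lt_of_le (by simp; positivity) hcard
  obtain ⟨t0, ht0⟩ : T'.Nonempty := Finset.card_pos.1 (by exact_mod_cast hT'pos)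
  simp only [cand, Finset.mem_filter, Finset.mem_univ, true_and,
    List.forall_mem_map, List.mem_range] at hmem
  have hss : ∀ k < r + 1, ∀ j < k, (G (g (j, k))).Adj (s j) (s k) :=
    fun k hk j hj => (hmem t0 ht0 k hk).2 j hj
  refine ⟨s, g, ?_, nodup_vc (injOn_of_adj hss) hg1, ?_⟩
  · apply tile_mem
    rintro ⟨i, j⟩ hp
    rw [mem_E] at hp
    exact hss j (by simp at hp; omega) i hp.1
  · intro b hb
    unfold tile at hb
    rw [Multiset.mem_add, mem_vsum, mem_csum] at hb
    rcases hb with ⟨i, hi, rfl⟩ | ⟨p, hp, rfl⟩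
    · exact (hmem t0 ht0 i (Finset.mem_range.1 hi)).1
    · exact hg2 p hp

end Absorb
end RainbowFactor

namespace RainbowFactor
section Layers
variable {V κ : Type}

/-- Index type of leftover tuples. -/
abbrev Tup (V κ : Type) (r : ℕ) : Type :=
  (Fin (r + 1) → V) × (Fin (r + 1) × Fin (r + 1) → κ)

noncomputable def tup (r : ℕ) (t : Tup V κ r) : Multiset (V ⊕ κ) :=
  tile r (fun i => t.1 (Fin.ofNat (r + 1) i))
    (fun p => t.2 (Fin.ofNat (r + 1) p.1, Fin.ofNat (r + 1) p.2))

lemma exists_tup (r : ℕ) (f : ℕ → V) (g : ℕ × ℕ → κ) : ∃ t : Tup V κ r, tup r t = tile r f g := by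
  refine ⟨(fun i => f i, fun p => g (p.1, p.2)), ?_⟩
  unfold tup tile vsum csum
  congr 1
  · apply Finset.sum_congr rfl
    intro i hi
    rw [Finset.mem_range] at hi
    simp [Fin.ofNat, Nat.mod_eq_of_lt hi]
  · apply Finset.sum_congr rfl
    rintro ⟨i, j⟩ hp
    rw [mem_E] at hp
    simp only at hp
    simp [Fin.ofNat, Nat.mod_eq_of_lt (show i < r + 1 by omega),
      Nat.mod_eq_of_lt (show j < r + 1 by omega)]

lemma card_tile {r : ℕ} {f : ℕ → V} {g : ℕ × ℕ → κ} :
    (tile r f g).card = r + 1 + (E r).card := by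
  unfold tile; rw [Multiset.card_add, card_vsum, card_csum, Finset.card_range]

/-- One-step absorption property. -/
def Step {τ : Type} (r : ℕ) (G : κ → SimpleGraph V) (L : τ → Multiset (V ⊕ κ)) (m1 : ℕ) (c1 : ℝ)
    (a1 : ℕ) : Prop :=
  ∀ F : Finset (V ⊕ κ), F.card + a1 ≤ m1 → ∀ T : Finset τ, T.Nonempty →
    ∃ (A : Multiset (V ⊕ κ)) (T' : Finset τ), T' ⊆ T ∧ c1 * T.card ≤ T'.card ∧ A.Nodup ∧
      (∀ b ∈ A, b ∉ F) ∧ A.card ≤ a1 ∧ A ∈ Cl r G ∧ ∀ t ∈ T', A + L t ∈ Cl r G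

lemma absorb_one [Fintype V] [Fintype κ] {r : ℕ} (hr : 1 ≤ r) {δ : ℝ} {G : κ → SimpleGraph V}
    (h : Deg r δ G) (hδ0 : 0 < δ)
    (hδ : δ ≤ 1) (m0 : ℕ) (hm : (m0 : ℝ) ≤ δ / 2 * Fintype.card V)
    (hκ : m0 + (E r).card ≤ Fintype.card κ) (v0 : V) (d0 : κ) :
    Step r G (tup (V := V) (κ := κ) r) m0 (((δ / 2) ^ (r + 1)) ^ (r + 1 + (E r).card))
      ((r + 1 + (E r).card) * (r + 1 + (E r).card) + (r + 1 + (E r).card)) := by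
  intro F hF T hT
  set b0 := r + 1 + (E r).card with hb0
  obtain ⟨x, d, hx1, hx2, hx3⟩ := exists_clique h hδ0 hδ F
    (le_trans (by exact_mod_cast (by omega : F.card ≤ m0)) hm) (by omega) v0 d0
  set S : Finset (ℕ ⊕ (ℕ × ℕ)) := (Finset.range (r + 1)).disjSum (E r) with hS
  have hScard : S.card = b0 := by rw [hS, Finset.card_disjSum, Finset.card_range]
  have hF' : (F ∪ (tile r x d).toFinset).card + b0 * b0 ≤ m0 := by
    have h1 := Finset.card_union_le F (tile r x d).toFinset
    have h2 := Multiset.toFinset_card_le (tile r x d)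
    rw [card_tile] at h2
    omega
  obtain ⟨B, T', h1, h2, h3, h4, h5, h6, h7⟩ := swap_sum (τ := Tup V κ r) (r := r) (G := G)
    (m0 := m0) (c0 := (δ / 2) ^ (r + 1)) (by positivity) (b0 := b0)
    (Sum.elim (fun i => Sum.inl (x i)) (fun p => Sum.inr (d p)))
    (Sum.elim (fun i t => Sum.inl (t.1 (Fin.ofNat (r + 1) i)))
      (fun p t => Sum.inr (t.2 (Fin.ofNat (r + 1) p.1, Fin.ofNat (r + 1) p.2)))) S
    (by
      rintro (i | p) _
      · exact vswap h hδ0 hδ m0 hm hκ d0 _ _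
      · exact cswap hr h hδ0 hδ m0 hm hκ v0 _ _) _ (by rw [hScard]; exact hF') T hT
  rw [hScard] at h2 h5
  rw [hS, Finset.sum_disjSum] at h6
  refine ⟨B + tile r x d, T', h1, h2, ?_, ?_, ?_, ?_, ?_⟩
  · rw [Multiset.nodup_add]
    refine ⟨h3, hx2, ?_⟩
    rw [Multiset.disjoint_left]
    intro b hb hb'
    exact h4 b hb (by simp [hb'])
  · intro b hb
    rcases Multiset.mem_add.1 hb with hb | hb
    · intro hF'; exact h4 b hb (by simp [hF'])
    · exact hx3 b hb
  · rw [Multiset.card_add, card_tile]; omega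
  · exact h6
  · intro t ht
    have := h7 t ht
    rw [hS, Finset.sum_disjSum] at this
    have h8 : B + tup r t ∈ Cl r G := this
    have := add_mem h8 hx1
    convert this using 1; abel

lemma layer {τ : Type} [Fintype τ] {r : ℕ} {G : κ → SimpleGraph V} {L : τ → Multiset (V ⊕ κ)}
    {m1 : ℕ} {c1 : ℝ} (hc1 : c1 ≤ 1) {a1 : ℕ} (H : Step r G L m1 c1 a1) (s : ℕ)
    (F : Finset (V ⊕ κ)) (hF : F.card + s * a1 ≤ m1) :
    ∃ (A : Multiset (V ⊕ κ)) (T : Finset τ), (T.card : ℝ) ≤ (1 - c1) ^ s * Fintype.card τ ∧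
      A.Nodup ∧ (∀ b ∈ A, b ∉ F) ∧ A.card ≤ s * a1 ∧ A ∈ Cl r G ∧ ∀ t ∉ T, A + L t ∈ Cl r G := by
  induction s with
  | zero =>
    exact ⟨0, Finset.univ, by simp, by simp, by simp, by simp, zero_mem _, by simp⟩
  | succ s ih =>
    rw [Nat.add_mul, one_mul] at hF ⊢
    obtain ⟨A, T, h1, h2, h3, h4, h5, h6⟩ := ih (by omega)
    have hc : 0 ≤ 1 - c1 := by linarith
    rcases T.eq_empty_or_nonempty with hT | hT
    · subst hT
      refine ⟨A, ∅, ?_, h2, h3, by omega, h5, h6⟩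
      simp only [Finset.card_empty, Nat.cast_zero]
      positivity
    · have hFB : (F ∪ A.toFinset).card + a1 ≤ m1 := by
        have := Finset.card_union_le F A.toFinset
        have := Multiset.toFinset_card_le A
        omega
      obtain ⟨A', T', g1, g2, g3, g4, g5, g6, g7⟩ := H _ hFB T hT
      refine ⟨A + A', T \ T', ?_, ?_, ?_, ?_, add_mem h5 g6, ?_⟩
      · rw [Finset.card_sdiff_of_subset g1, Nat.cast_sub (Finset.card_le_card g1)]
        calc (T.card : ℝ) - T'.card ≤ (1 - c1) * T.card := by linarith
          _ ≤ (1 - c1) * ((1 - c1) ^ s * Fintype.card τ) := by gcongr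
          _ = _ := by ring
      · rw [Multiset.nodup_add]
        refine ⟨h2, g3, ?_⟩
        rw [Multiset.disjoint_left]
        intro b hb hb'
        exact g4 b hb' (by simp [hb])
      · intro b hb
        rcases Multiset.mem_add.1 hb with hb | hb
        · exact h3 b hb
        · intro hF'; exact g4 b hb (by simp [hF'])
      · rw [Multiset.card_add]; omega
      · intro t ht
        by_cases htT : t ∈ T
        · have htT' : t ∈ T' := by
            by_contra hcon
            exact ht (Finset.mem_sdiff.2 ⟨htT, hcon⟩)
          have := add_mem h5 (g7 t htT')
          convert this using 1; abel
        · have := add_mem (h6 t htT) g6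
          convert this using 1; abel

lemma layers {τ : Type} [Fintype τ] {r : ℕ} {G : κ → SimpleGraph V} {L : τ → Multiset (V ⊕ κ)}
    {m1 : ℕ} {c1 : ℝ} (hc1 : c1 ≤ 1) {a1 : ℕ} (H : Step r G L m1 c1 a1) (s : ℕ)
    (hs : (1 - c1) ^ s * Fintype.card τ < 1) (j : ℕ)
    (hj : j * (s * a1) ≤ m1) :
    ∃ A : Multiset (V ⊕ κ), A.Nodup ∧ A.card ≤ j * (s * a1) ∧
      ∀ l : List τ, l.length ≤ j → A + (l.map L).sum ∈ Cl r G := by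
  induction j with
  | zero =>
    refine ⟨0, by simp, by simp, ?_⟩
    intro l hl
    have : l = [] := List.length_eq_zero_iff.1 (by omega)
    subst this
    simp [zero_mem]
  | succ j ih =>
    rw [Nat.add_mul, one_mul] at hj ⊢
    obtain ⟨A, h1, h2, h3⟩ := ih (by omega)
    obtain ⟨A', T, g1, g2, g3, g4, g5, g6⟩ := layer hc1 H s A.toFinset (by
      have := Multiset.toFinset_card_le A
      omega)
    have hT : T = ∅ := by
      rw [← Finset.card_eq_zero]
      have : (T.card : ℝ) < 1 := lt_of_le_of_lt g1 hs
      have : T.card < 1 := by exact_mod_cast this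
      omega
    subst hT
    refine ⟨A + A', ?_, ?_, ?_⟩
    · rw [Multiset.nodup_add]
      refine ⟨h1, g2, ?_⟩
      rw [Multiset.disjoint_left]
      intro b hb hb'
      exact g3 b hb' (by simp [hb])
    · rw [Multiset.card_add]; omega
    · intro l hl
      rcases l with _ | ⟨t, l⟩
      · have := add_mem (h3 [] (by simp)) g5
        convert this using 1; simp
      · have := add_mem (h3 l (by simpa using hl)) (g6 t (by simp))
        convert this using 1
        simp only [List.map_cons, List.sum_cons]
        abel

/-- Asymptotics: exponential beats polynomial. -/
lemma asymp (c : ℝ) (hc0 : 0 < c) (hc1 : c ≤ 1) (K : ℝ) (hK : 0 ≤ K) (P : ℕ) :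
    ∃ s0 : ℕ, ∀ s ≥ s0, (1 - c) ^ s * (K * (s + 1)) ^ P < 1 := by
  rcases eq_or_lt_of_le hc1 with h | h
  · refine ⟨1, fun s hs => ?_⟩
    rw [h, sub_self, zero_pow (by omega)]; simp
  · have h1 := tendsto_pow_const_mul_const_pow_of_abs_lt_one P (r := 1 - c)
      (by rw [abs_of_pos] <;> linarith)
    have h2 := (h1.comp (Filter.tendsto_add_atTop_nat 1)).const_mul (K ^ P / (1 - c))
    rw [mul_zero] at h2
    obtain ⟨s0, hs0⟩ := Filter.eventually_atTop.1 (h2.eventually (gt_mem_nhds zero_lt_one))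
    refine ⟨s0, fun s hs => ?_⟩
    have := hs0 s hs
    simp only [Function.comp] at this
    have hne : (1 - c) ≠ 0 := by linarith
    have e : (1 - c) ^ s * (K * (s + 1)) ^ P =
        K ^ P / (1 - c) * (((s + 1 : ℕ) : ℝ) ^ P * (1 - c) ^ (s + 1)) := by
      push_cast
      rw [mul_pow, pow_succ]
      field_simp
    rw [e]; exact this

/-- The absorbing set. -/
lemma exists_absorber (r : ℕ) (hr : 1 ≤ r) (δ : ℝ) (hδ0 : 0 < δ) (hδ : δ ≤ 1) (W : ℕ) :
    ∃ n0 : ℕ, ∀ (V κ : Type) [Fintype V] [Fintype κ] (G : κ → SimpleGraph V),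
      n0 ≤ Fintype.card V → 2 * Fintype.card κ = r * Fintype.card V → Deg r δ G →
      ∃ A : Multiset (V ⊕ κ), A.Nodup ∧ (A.card : ℝ) ≤ δ / 4 * Fintype.card V ∧
      ∀ l : List (Tup V κ r), l.length ≤ W → A + (l.map (tup r)).sum ∈ Cl r G := by
  set b0 := r + 1 + (E r).card with hb0
  set a1 := b0 * b0 + b0 with ha1
  set c1 : ℝ := ((δ / 2) ^ (r + 1)) ^ b0 with hc1
  have hc1pos : 0 < c1 := by positivity
  have hc1le : c1 ≤ 1 := by
    apply pow_le_one₀ (by positivity)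
    apply pow_le_one₀ (by positivity) (by linarith)
  set Q : ℕ := (W + 1) * a1 with hQ
  have hQpos : 0 < Q := by positivity
  set K : ℝ := Q * (4 / δ) with hK
  have hK0 : 0 < K := by
    have : (0 : ℝ) < Q := by exact_mod_cast hQpos
    positivity
  set P : ℕ := (r + 1) + (r + 1) * (r + 1) with hP
  obtain ⟨s0, hs0⟩ := asymp c1 hc1pos hc1le (r * K) (by positivity) P
  obtain ⟨n1, hn1⟩ := exists_nat_ge (K * (s0 + 1))
  refine ⟨max n1 (4 * (E r).card + 1), ?_⟩
  intro V κ _ _ G hn hκ hdeg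
  set n := Fintype.card V with hnV
  have hn1' : n1 ≤ n := (le_max_left _ _).trans hn
  have hn2' : 4 * (E r).card + 1 ≤ n := (le_max_right _ _).trans hn
  set m0 := ⌊δ / 4 * n⌋₊ with hm0
  have hm0le : (m0 : ℝ) ≤ δ / 4 * n := Nat.floor_le (by positivity)
  have hm0lt : δ / 4 * n < m0 + 1 := Nat.lt_floor_add_one _
  have hm4 : 4 * m0 ≤ n := by
    have : (4 : ℝ) * m0 ≤ n := by
      have : δ / 4 * n ≤ 1 / 4 * n := by gcongr
      linarith
    exact_mod_cast this
  have hκn : n ≤ 2 * Fintype.card κ := by rw [hκ]; exact Nat.le_mul_of_pos_left _ (by omega)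
  have hκpos : 0 < Fintype.card κ := by omega
  obtain ⟨v0⟩ : Nonempty V := Fintype.card_pos_iff.1 (by omega)
  obtain ⟨d0⟩ : Nonempty κ := Fintype.card_pos_iff.1 hκpos
  have hstep := absorb_one hr hdeg hδ0 hδ m0 (by
    refine hm0le.trans ?_
    have : δ / 4 ≤ δ / 2 := by linarith
    gcongr) (by omega) v0 d0
  set s := m0 / Q with hs
  have hs1 : m0 + 1 ≤ (s + 1) * Q := by
    have := Nat.lt_div_mul_add (a := m0) hQpos
    rw [← hs] at this
    rw [Nat.add_mul, one_mul]; exact this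
  have hnK : (n : ℝ) ≤ K * (s + 1) := by
    have h1 : ((m0 : ℝ) + 1) ≤ (s + 1) * Q := by exact_mod_cast hs1
    have h2 : δ / 4 * n ≤ (s + 1) * Q := by linarith
    have h3 : (n : ℝ) = 4 / δ * (δ / 4 * n) := by field_simp
    rw [h3, hK]
    calc 4 / δ * (δ / 4 * n) ≤ 4 / δ * ((s + 1) * Q) := by gcongr
      _ = _ := by ring
  have hss0 : s0 ≤ s := by
    have h1 : (n1 : ℝ) ≤ n := by exact_mod_cast hn1'
    have h2 : K * (s0 + 1) ≤ K * (s + 1) := by linarith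
    have h3 := le_of_mul_le_mul_left h2 hK0
    have : (s0 : ℝ) ≤ s := by linarith
    exact_mod_cast this
  have hτ : (Fintype.card (Tup V κ r) : ℝ) ≤ (r * K * (s + 1)) ^ P := by
    have h1 : Fintype.card (Tup V κ r) =
        n ^ (r + 1) * Fintype.card κ ^ ((r + 1) * (r + 1)) := by
      simp [Tup, Fintype.card_prod, hnV]
    have h2 : Fintype.card κ ≤ r * n := by omega
    have h3 : n ≤ r * n := Nat.le_mul_of_pos_left _ (by omega)
    have h4 : Fintype.card (Tup V κ r) ≤ (r * n) ^ P := by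
      rw [h1, hP, pow_add (r * n)]
      exact Nat.mul_le_mul (Nat.pow_le_pow_left h3 _) (Nat.pow_le_pow_left h2 _)
    calc (Fintype.card (Tup V κ r) : ℝ) ≤ ((r : ℝ) * n) ^ P := by exact_mod_cast h4
      _ ≤ (r * K * (s + 1)) ^ P := by
        rw [mul_assoc]
        exact pow_le_pow_left₀ (by positivity) (mul_le_mul_of_nonneg_left hnK (by positivity)) _
  obtain ⟨A, h1, h2, h3⟩ := layers hc1le hstep s (by
    refine lt_of_le_of_lt ?_ (hs0 s hss0)
    have : 0 ≤ 1 - c1 := by linarith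
    gcongr) W (by
      calc W * (s * a1) ≤ s * Q := by rw [hQ]; nlinarith [Nat.zero_le (s * a1)]
        _ ≤ m0 := Nat.div_mul_le_self _ _)
  refine ⟨A, h1, ?_, h3⟩
  have h4 : W * (s * a1) ≤ m0 := by
      calc W * (s * a1) ≤ s * Q := by rw [hQ]; nlinarith [Nat.zero_le (s * a1)]
        _ ≤ m0 := Nat.div_mul_le_self _ _
  calc (A.card : ℝ) ≤ m0 := by exact_mod_cast h2.trans h4
    _ ≤ _ := hm0le
end Layers
end RainbowFactor

namespace RainbowFactor
section Split
variable {V κ : Type}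

/-- vertex part of a multiset -/
noncomputable def lft (X : Multiset (V ⊕ κ)) : Multiset V := X.filterMap Sum.getLeft?
/-- colour part of a multiset -/
noncomputable def rgt (X : Multiset (V ⊕ κ)) : Multiset κ := X.filterMap Sum.getRight?

lemma lft_add (X Y : Multiset (V ⊕ κ)) : lft (X + Y) = lft X + lft Y := by
  unfold lft
  induction X using Multiset.induction_on with
  | empty => simp
  | cons a X ih =>
    rw [Multiset.cons_add]
    cases a with
    | inl v => simp [Multiset.filterMap_cons_some (Sum.getLeft? : V ⊕ κ → Option V) (Sum.inl v) _ rfl, ih]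
    | inr c => simp [Multiset.filterMap_cons_none (f := (Sum.getLeft? : V ⊕ κ → Option V)) (Sum.inr c) _ rfl, ih]

lemma rgt_add (X Y : Multiset (V ⊕ κ)) : rgt (X + Y) = rgt X + rgt Y := by
  unfold rgt
  induction X using Multiset.induction_on with
  | empty => simp
  | cons a X ih =>
    rw [Multiset.cons_add]
    cases a with
    | inr v => simp [Multiset.filterMap_cons_some (Sum.getRight? : V ⊕ κ → Option κ) (Sum.inr v) _ rfl, ih]
    | inl c => simp [Multiset.filterMap_cons_none (f := (Sum.getRight? : V ⊕ κ → Option κ)) (Sum.inl c) _ rfl, ih]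

lemma lft_inl (A : Multiset V) : lft (A.map Sum.inl : Multiset (V ⊕ κ)) = A := by
  unfold lft; rw [Multiset.filterMap_map]
  exact Multiset.filterMap_some A

lemma lft_inr (A : Multiset κ) : lft (A.map Sum.inr : Multiset (V ⊕ κ)) = 0 := by
  unfold lft
  induction A using Multiset.induction_on with
  | empty => simp
  | cons a A ih => rw [Multiset.map_cons, Multiset.filterMap_cons_none _ _ rfl, ih]

lemma rgt_inr (A : Multiset κ) : rgt (A.map Sum.inr : Multiset (V ⊕ κ)) = A := by
  unfold rgt; rw [Multiset.filterMap_map]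
  exact Multiset.filterMap_some A

lemma rgt_inl (A : Multiset V) : rgt (A.map Sum.inl : Multiset (V ⊕ κ)) = 0 := by
  unfold rgt
  induction A using Multiset.induction_on with
  | empty => simp
  | cons a A ih => rw [Multiset.map_cons, Multiset.filterMap_cons_none _ _ rfl, ih]

lemma lft_rgt (X : Multiset (V ⊕ κ)) : X = (lft X).map Sum.inl + (rgt X).map Sum.inr := by
  induction X using Multiset.induction_on with
  | empty => simp [lft, rgt]
  | cons a X ih =>
    rw [← Multiset.singleton_add, lft_add, rgt_add, Multiset.map_add, Multiset.map_add]
    have h : ({a} : Multiset (V ⊕ κ)) = (lft {a}).map Sum.inl + (rgt {a}).map Sum.inr := by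
      cases a with
      | inl v =>
        have : ({Sum.inl v} : Multiset (V ⊕ κ)) = ({v} : Multiset V).map Sum.inl := by simp
        rw [this, lft_inl, rgt_inl]; simp
      | inr v =>
        have : ({Sum.inr v} : Multiset (V ⊕ κ)) = ({v} : Multiset κ).map Sum.inr := by simp
        rw [this, lft_inr, rgt_inr]; simp
    conv_lhs => rw [h, ih]
    abel

lemma tile_eq (r : ℕ) (f : ℕ → V) (g : ℕ × ℕ → κ) :
    tile r f g = ((Finset.range (r + 1)).val.map f).map Sum.inl + ((E r).val.map g).map Sum.inr := by
  unfold tile vsum csum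
  rw [sum_singleton_eq, sum_singleton_eq, Multiset.map_map, Multiset.map_map]; rfl

lemma lft_tile (r : ℕ) (f : ℕ → V) (g : ℕ × ℕ → κ) :
    lft (tile r f g) = (Finset.range (r + 1)).val.map f := by
  rw [tile_eq, lft_add, lft_inl, lft_inr, add_zero]

lemma rgt_tile (r : ℕ) (f : ℕ → V) (g : ℕ × ℕ → κ) :
    rgt (tile r f g) = (E r).val.map g := by
  rw [tile_eq, rgt_add, rgt_inl, rgt_inr, zero_add]

lemma univ_sum_eq [Fintype V] [Fintype κ] : (Finset.univ.val : Multiset (V ⊕ κ)) =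
    (Finset.univ.val : Multiset V).map Sum.inl + (Finset.univ.val : Multiset κ).map Sum.inr := by
  rw [← Finset.univ_disjSum_univ]; rfl

lemma lft_univ [Fintype V] [Fintype κ] :
    lft (Finset.univ.val : Multiset (V ⊕ κ)) = Finset.univ.val := by
  rw [univ_sum_eq, lft_add, lft_inl, lft_inr, add_zero]

lemma rgt_univ [Fintype V] [Fintype κ] :
    rgt (Finset.univ.val : Multiset (V ⊕ κ)) = Finset.univ.val := by
  rw [univ_sum_eq, rgt_add, rgt_inl, rgt_inr, zero_add]

lemma exists_map {ι α : Type} [Nonempty α] (s : Finset ι) (A : Multiset α) (h : A.card = s.card) :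
    ∃ f : ι → α, s.val.map f = A := by
  induction s using Finset.induction_on generalizing A with
  | empty =>
    refine ⟨fun _ => Classical.arbitrary α, ?_⟩
    rw [Finset.card_empty, Multiset.card_eq_zero] at h
    simp [h]
  | insert a s ha ih =>
    rw [Finset.card_insert_of_notMem ha, Multiset.card_eq_succ_iff] at h
    obtain ⟨b, B, rfl, hB⟩ := h
    obtain ⟨f, hf⟩ := ih B hB
    refine ⟨Function.update f a b, ?_⟩
    rw [Finset.insert_val_of_notMem ha, Multiset.map_cons, Function.update_self, ← hf]
    congr 1
    apply Multiset.map_congr rfl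
    intro x hx
    rw [Function.update_of_ne]
    rintro rfl
    exact ha hx

lemma exists_sub {α : Type} (A : Multiset α) (k : ℕ) (h : k ≤ A.card) : ∃ B ≤ A, B.card = k := by
  have : 0 < (Multiset.powersetCard k A).card := by
    rw [Multiset.card_powersetCard]; exact Nat.choose_pos h
  obtain ⟨B, hB⟩ := Multiset.card_pos_iff_exists_mem.1 this
  exact ⟨B, Multiset.mem_powersetCard.1 hB⟩

/-- every balanced multiset is a sum of tuples. -/
lemma exists_list_tup [Nonempty V] [Nonempty κ] (r w : ℕ) (A : Multiset V) (B : Multiset κ)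
    (hA : A.card = (r + 1) * w) (hB : B.card = (E r).card * w) :
    ∃ l : List (Tup V κ r), l.length = w ∧
      (l.map (tup r)).sum = A.map Sum.inl + B.map Sum.inr := by
  induction w generalizing A B with
  | zero =>
    refine ⟨[], rfl, ?_⟩
    rw [mul_zero, Multiset.card_eq_zero] at hA hB
    simp [hA, hB]
  | succ w ih =>
    obtain ⟨A1, hA1, hA1c⟩ := exists_sub A (r + 1) (by rw [hA]; nlinarith)
    obtain ⟨B1, hB1, hB1c⟩ := exists_sub B (E r).card (by rw [hB]; nlinarith)
    obtain ⟨A2, rfl⟩ := Multiset.le_iff_exists_add.1 hA1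
    obtain ⟨B2, rfl⟩ := Multiset.le_iff_exists_add.1 hB1
    rw [Multiset.card_add] at hA hB
    obtain ⟨l, hl, hsum⟩ := ih A2 B2 (by rw [mul_add] at hA; omega) (by rw [mul_add] at hB; omega)
    obtain ⟨f, hf⟩ := exists_map (Finset.range (r + 1)) A1 (by simpa using hA1c)
    obtain ⟨g, hg⟩ := exists_map (E r) B1 hB1c
    obtain ⟨t, ht⟩ := exists_tup r f g
    refine ⟨t :: l, by simp [hl], ?_⟩
    rw [List.map_cons, List.sum_cons, hsum, ht, tile_eq, hf, hg, Multiset.map_add, Multiset.map_add]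
    abel

lemma mem_Cl {r : ℕ} {G : κ → SimpleGraph V} {X : Multiset (V ⊕ κ)} (h : X ∈ Cl r G) :
    ∃ l : List ((ℕ → V) × (ℕ × ℕ → κ)),
      (∀ t ∈ l, ∀ p ∈ E r, (G (t.2 p)).Adj (t.1 p.1) (t.1 p.2)) ∧
      lft X = (l.map (fun t => (Finset.range (r + 1)).val.map t.1)).sum ∧
      rgt X = (l.map (fun t => (E r).val.map t.2)).sum := by
  unfold Cl at h
  induction h using AddSubmonoid.closure_induction with
  | mem X hX =>
    obtain ⟨f, g, h, rfl⟩ := hX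
    exact ⟨[(f, g)], by simpa using h, by simp [lft_tile], by simp [rgt_tile]⟩
  | zero => exact ⟨[], by simp, by simp [lft], by simp [rgt]⟩
  | add X Y _ _ hX hY =>
    obtain ⟨l, h1, h2, h3⟩ := hX
    obtain ⟨l', h1', h2', h3'⟩ := hY
    refine ⟨l ++ l', ?_, ?_, ?_⟩
    · intro t ht
      rcases List.mem_append.1 ht with h | h
      · exact h1 t h
      · exact h1' t h
    · rw [lft_add, h2, h2', List.map_append, List.sum_append]
    · rw [rgt_add, h3, h3', List.map_append, List.sum_append]

lemma card_list_sum {α ι : Type} (l : List ι) (F : ι → Multiset α) (c : ℕ) (h : ∀ t, (F t).card = c) :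
    (l.map F).sum.card = c * l.length := by
  induction l with
  | nil => simp
  | cons a l ih => simp [ih, h]; ring

lemma count_Cl {r : ℕ} {G : κ → SimpleGraph V} {X : Multiset (V ⊕ κ)} (h : X ∈ Cl r G) :
    ∃ k, (lft X).card = (r + 1) * k ∧ (rgt X).card = (E r).card * k := by
  obtain ⟨l, -, h2, h3⟩ := mem_Cl h
  refine ⟨l.length, ?_, ?_⟩
  · rw [h2, card_list_sum _ _ (r + 1)]; simp
  · rw [h3, card_list_sum _ _ (E r).card]; simp
end Split
end RainbowFactor

namespace RainbowFactor
section Main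
variable {V κ : Type}

lemma mem_lft {X : Multiset (V ⊕ κ)} {v : V} : v ∈ lft X ↔ Sum.inl v ∈ X := by
  conv_rhs => rw [lft_rgt X]
  simp

lemma mem_rgt {X : Multiset (V ⊕ κ)} {c : κ} : c ∈ rgt X ↔ Sum.inr c ∈ X := by
  conv_rhs => rw [lft_rgt X]
  simp

lemma nodup_lft {X : Multiset (V ⊕ κ)} (h : X.Nodup) : (lft X).Nodup := by
  rw [lft_rgt X, Multiset.nodup_add] at h
  exact h.1.of_map

lemma nodup_rgt {X : Multiset (V ⊕ κ)} (h : X.Nodup) : (rgt X).Nodup := by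
  rw [lft_rgt X, Multiset.nodup_add] at h
  exact h.2.1.of_map

lemma card_lft_eq [Fintype V] {X : Multiset (V ⊕ κ)} (h : X.Nodup) :
    (lft X).card = (Finset.univ.filter (fun v => Sum.inl v ∈ X)).card := by
  have : (Finset.univ.filter (fun v => Sum.inl v ∈ X)) = (lft X).toFinset := by
    ext v; simp [mem_lft]
  rw [this, Multiset.toFinset_card_of_nodup (nodup_lft h)]

lemma card_rgt_eq [Fintype κ] {X : Multiset (V ⊕ κ)} (h : X.Nodup) :
    (rgt X).card = (Finset.univ.filter (fun v => Sum.inr v ∈ X)).card := by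
  have : (Finset.univ.filter (fun v => Sum.inr v ∈ X)) = (rgt X).toFinset := by
    ext v; simp [mem_rgt]
  rw [this, Multiset.toFinset_card_of_nodup (nodup_rgt h)]

lemma card_lft_le (X : Multiset (V ⊕ κ)) : (lft X).card ≤ X.card := by
  conv_rhs => rw [lft_rgt X]
  simp

/-- the tile of one full class -/
lemma one_class [Fintype V] {r : ℕ} {G : κ → SimpleGraph V} {part : V → V} {ψ : V → V → κ}
    (hv : Valid r G part ψ) (l : V) (hl : (cls part l).card = r + 1) :
    ∃ T : Multiset (V ⊕ κ), T ∈ Cl r G ∧ T.Nodup ∧ (∀ v, Sum.inl v ∈ T ↔ part v = l) ∧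
      ∀ c, Sum.inr c ∈ T → ∃ u v, u ≠ v ∧ part u = l ∧ part v = l ∧ ψ u v = c := by
  obtain ⟨-, hv2, hv3⟩ := hv
  have : Nonempty V := ⟨l⟩
  obtain ⟨f, hf⟩ := exists_map (Finset.range (r + 1)) (cls part l).val (by simpa using hl)
  have hinj : Set.InjOn f (Finset.range (r + 1) : Set ℕ) := by
    intro x hx y hy hxy
    refine Multiset.inj_on_of_nodup_map (f := f) (s := (Finset.range (r + 1)).val) ?_ x hx y hy hxy
    rw [hf]; exact (cls part l).nodup
  have hmem : ∀ v, (∃ i ∈ Finset.range (r + 1), f i = v) ↔ part v = l := by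
    intro v
    rw [← mem_cls, ← Finset.mem_val, ← hf, Multiset.mem_map]; rfl
  have hp : ∀ i ≤ r, part (f i) = l := fun i hi =>
    (hmem _).1 ⟨i, Finset.mem_range.2 (by omega), rfl⟩
  have hfne : ∀ p ∈ E r, f p.1 ≠ f p.2 := by
    intro p hpE h
    rw [mem_E] at hpE
    have := hinj (by simp; omega) (by simp; omega) h
    omega
  have hpart : ∀ p ∈ E r, part (f p.1) = part (f p.2) := by
    intro p hpE
    rw [mem_E] at hpE
    rw [hp _ (by omega), hp _ (by omega)]
  refine ⟨tile r f (fun p => ψ (f p.1) (f p.2)), ?_, ?_, ?_, ?_⟩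
  · exact tile_mem fun p hpE => (hv2 _ _ (hfne p hpE) (hpart p hpE)).1
  · refine nodup_vc hinj ?_
    intro p hpE q hqE h
    have h1 := hv3 _ _ _ _ (hfne p hpE) (hpart p hpE) (hfne q hqE) (hpart q hqE) h
    have hpE := mem_E.1 (Finset.mem_coe.1 hpE)
    have hqE := mem_E.1 (Finset.mem_coe.1 hqE)
    rcases h1 with ⟨h1, h2⟩ | ⟨h1, h2⟩
    · have := hinj (by simp; omega) (by simp; omega) h1
      have := hinj (by simp; omega) (by simp; omega) h2
      ext <;> assumption
    · have := hinj (by simp; omega) (by simp; omega) h1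
      have := hinj (by simp; omega) (by simp; omega) h2
      omega
  · intro v
    rw [← mem_lft, lft_tile, ← hmem, Multiset.mem_map]; rfl
  · intro c hc
    rw [← mem_rgt, rgt_tile, Multiset.mem_map] at hc
    obtain ⟨p, hpE, rfl⟩ := hc
    have hpE' := mem_E.1 hpE
    exact ⟨_, _, hfne p hpE, hp _ (by omega), hp _ (by omega), rfl⟩

lemma all_classes [Fintype V] {r : ℕ} {G : κ → SimpleGraph V} {part : V → V} {ψ : V → V → κ}
    (hv : Valid r G part ψ) (S : Finset V) (hS : ∀ l ∈ S, (cls part l).card = r + 1) :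
    ∃ T : Multiset (V ⊕ κ), T ∈ Cl r G ∧ T.Nodup ∧ (∀ v, Sum.inl v ∈ T ↔ part v ∈ S) ∧
      ∀ c, Sum.inr c ∈ T → ∃ u v, u ≠ v ∧ part u = part v ∧ part v ∈ S ∧ ψ u v = c := by
  induction S using Finset.induction_on with
  | empty => exact ⟨0, zero_mem _, Multiset.nodup_zero, by simp, by simp⟩
  | insert l S hlS ih =>
    obtain ⟨T, h1, h2, h3, h4⟩ := ih (fun k hk => hS k (Finset.mem_insert_of_mem hk))
    obtain ⟨T', h1', h2', h3', h4'⟩ := one_class hv l (hS l (Finset.mem_insert_self _ _))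
    refine ⟨T' + T, add_mem h1' h1, ?_, ?_, ?_⟩
    · rw [Multiset.nodup_add]
      refine ⟨h2', h2, ?_⟩
      rw [Multiset.disjoint_left]
      rintro (v | c) ha hb
      · rw [h3'] at ha
        rw [h3, ha] at hb
        exact hlS hb
      · obtain ⟨u, v, a1, a2, a3, a4⟩ := h4' c ha
        obtain ⟨u', v', b1, b2, b3, b4⟩ := h4 c hb
        rcases hv.2.2 u v u' v' a1 (a2.trans a3.symm) b1 b2 (a4.trans b4.symm) with ⟨rfl, rfl⟩ | ⟨rfl, rfl⟩
        · rw [a3] at b3; exact hlS b3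
        · rw [a2] at b3; exact hlS b3
    · intro v
      rw [Multiset.mem_add, h3, h3', Finset.mem_insert]
    · intro c hc
      rcases Multiset.mem_add.1 hc with h | h
      · obtain ⟨u, v, a1, a2, a3, a4⟩ := h4' c h
        exact ⟨u, v, a1, a2.trans a3.symm, by rw [a3]; exact Finset.mem_insert_self _ _, a4⟩
      · obtain ⟨u, v, a1, a2, a3, a4⟩ := h4 c h
        exact ⟨u, v, a1, a2, Finset.mem_insert_of_mem a3, a4⟩

lemma full_tiles [Fintype V] {r : ℕ} {G : κ → SimpleGraph V} {part : V → V} {ψ : V → V → κ}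
    (hv : Valid r G part ψ) {W : ℕ}
    (hW : (Finset.univ.filter (fun v => (cls part (part v)).card ≤ r)).card ≤ W) :
    ∃ T : Multiset (V ⊕ κ), T ∈ Cl r G ∧ T.Nodup ∧ Fintype.card V ≤ (lft T).card + W := by
  obtain ⟨T, h1, h2, h3, -⟩ := all_classes hv
    (Finset.univ.filter (fun l => (cls part l).card = r + 1)) (by simp)
  refine ⟨T, h1, h2, ?_⟩
  rw [card_lft_eq h2]
  have h5 := Finset.card_filter_add_card_filter_not (s := (Finset.univ : Finset V))
    (fun v => (Sum.inl v : V ⊕ κ) ∈ T)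
  rw [Finset.card_univ] at h5
  have h6 : (Finset.univ.filter (fun v => ¬ (Sum.inl v : V ⊕ κ) ∈ T)).card ≤ W := by
    refine le_trans (Finset.card_le_card ?_) hW
    intro v hv'
    simp only [Finset.mem_filter, Finset.mem_univ, true_and, h3] at hv' ⊢
    have := hv.1 (part v)
    omega
  omega

lemma map_Cl {V' κ' : Type} {r : ℕ} {G : κ → SimpleGraph V} {G' : κ' → SimpleGraph V'}
    (a : V' → V) (b : κ' → κ) (h : ∀ c u v, (G' c).Adj u v → (G (b c)).Adj (a u) (a v))
    {X : Multiset (V' ⊕ κ')} (hX : X ∈ Cl r G') : X.map (Sum.map a b) ∈ Cl r G := by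
  unfold Cl at hX
  induction hX using AddSubmonoid.closure_induction with
  | mem X hX =>
    obtain ⟨f, g, h', rfl⟩ := hX
    have : (tile r f g).map (Sum.map a b) = tile r (a ∘ f) (b ∘ g) := by
      rw [tile_eq, tile_eq]
      simp [Multiset.map_map, Function.comp_def]
    rw [this]
    exact tile_mem fun p hp => h _ _ _ (h' p hp)
  | zero => simp
  | add X Y _ _ hX hY => rw [Multiset.map_add]; exact add_mem hX hY

lemma card_lft_map {V' κ' : Type} (a : V' → V) (b : κ' → κ) (X : Multiset (V' ⊕ κ')) :
    (lft (X.map (Sum.map a b))).card = (lft X).card := by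
  conv_lhs => rw [lft_rgt X]
  have : ((lft X).map Sum.inl + (rgt X).map Sum.inr).map (Sum.map a b) =
      ((lft X).map a).map Sum.inl + ((rgt X).map b).map Sum.inr := by
    simp [Multiset.map_map, Function.comp_def]
  rw [this, lft_add, lft_inl, lft_inr]
  simp

lemma main (r : ℕ) (hr : 1 ≤ r) (δ : ℝ) (hδ0 : 0 < δ) (hδ : δ ≤ 1) :
    ∃ n0 : ℕ, ∀ (V κ : Type) [Fintype V] [Fintype κ] (G : κ → SimpleGraph V) (k : ℕ),
      n0 ≤ Fintype.card V → Fintype.card V = (r + 1) * k → Fintype.card κ = (E r).card * k →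
      Deg r δ G → (Finset.univ.val : Multiset (V ⊕ κ)) ∈ Cl r G := by
  obtain ⟨W, hW⟩ := search r (δ / 2) (by linarith)
  obtain ⟨n0, hn0⟩ := exists_absorber r hr δ hδ0 hδ W
  refine ⟨max n0 1, ?_⟩
  intro V κ _ _ G k hn hV hκ hdeg
  have h2E := two_mul_card_E r
  have hEpos : 0 < (E r).card := by
    have : 0 < r * (r + 1) := by positivity
    omega
  have hVpos : 0 < Fintype.card V := lt_of_lt_of_le (by simp) hn
  have hkpos : 0 < k := by
    rcases Nat.eq_zero_or_pos k with h | h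
    · rw [h] at hV; omega
    · exact h
  have hκpos : 0 < Fintype.card κ := by rw [hκ]; positivity
  have : Nonempty V := Fintype.card_pos_iff.1 hVpos
  have : Nonempty κ := Fintype.card_pos_iff.1 hκpos
  obtain ⟨A, hA1, hA2, hA3⟩ := hn0 V κ G (le_trans (le_max_left _ _) hn) (by
    rw [hV, hκ]; calc 2 * ((E r).card * k) = (2 * (E r).card) * k := by ring
      _ = _ := by rw [h2E]; ring) hdeg
  have hACl : A ∈ Cl r G := by simpa using hA3 [] (by simp)
  obtain ⟨ka, hka1, hka2⟩ := count_Cl hACl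
  -- the remaining structure
  let V' := {v : V // (Sum.inl v : V ⊕ κ) ∉ A}
  let κ' := {c : κ // (Sum.inr c : V ⊕ κ) ∉ A}
  let G' : κ' → SimpleGraph V' := fun c => (G c.1).comap Subtype.val
  have hV' : Fintype.card V' + (r + 1) * ka = (r + 1) * k := by
    have h5 := Finset.card_filter_add_card_filter_not (s := (Finset.univ : Finset V))
      (fun v => (Sum.inl v : V ⊕ κ) ∈ A)
    rw [← card_lft_eq hA1, hka1, Finset.card_univ, hV] at h5
    have : Fintype.card V' = (Finset.univ.filter (fun v => (Sum.inl v : V ⊕ κ) ∉ A)).card := by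
      rw [← Fintype.card_subtype]
    omega
  have hκ' : Fintype.card κ' + (E r).card * ka = (E r).card * k := by
    have h5 := Finset.card_filter_add_card_filter_not (s := (Finset.univ : Finset κ))
      (fun v => (Sum.inr v : V ⊕ κ) ∈ A)
    rw [← card_rgt_eq hA1, hka2, Finset.card_univ, hκ] at h5
    have : Fintype.card κ' = (Finset.univ.filter (fun v => (Sum.inr v : V ⊕ κ) ∉ A)).card := by
      rw [← Fintype.card_subtype]
    omega
  have hcard' : 2 * Fintype.card κ' = r * Fintype.card V' := by
    have e1 : 2 * Fintype.card κ' + r * ((r + 1) * ka) = r * ((r + 1) * k) := by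
      calc 2 * Fintype.card κ' + r * ((r + 1) * ka)
          = 2 * Fintype.card κ' + (r * (r + 1)) * ka := by ring
        _ = 2 * (Fintype.card κ' + (E r).card * ka) := by rw [← h2E]; ring
        _ = (2 * (E r).card) * k := by rw [hκ']; ring
        _ = _ := by rw [h2E]; ring
    have e2 : r * Fintype.card V' + r * ((r + 1) * ka) = r * ((r + 1) * k) := by
      rw [← mul_add, hV']
    omega
  have hbig : (1 - δ / 4) * (Fintype.card V : ℝ) ≤ Fintype.card V' := by
    have h1 : (lft A).card ≤ A.card := card_lft_le A
    have h2 : ((lft A).card : ℝ) ≤ A.card := by exact_mod_cast h1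
    have h3 : Fintype.card V' + (lft A).card = Fintype.card V := by rw [hka1, hV', hV]
    have h4 : (Fintype.card V' : ℝ) + (lft A).card = Fintype.card V := by exact_mod_cast h3
    linarith
  obtain ⟨part, ψ, hval, hWW⟩ := hW V' κ' G' hcard' (by
    intro c v
    have h1 := hdeg c.1 v.1
    have h2 : (Finset.univ.filter (fun u => ¬ (G' c).Adj v u)).card ≤
        (Finset.univ.filter (fun u => ¬ (G c.1).Adj v.1 u)).card := by
      rw [← Finset.card_map (Function.Embedding.subtype (fun v : V => (Sum.inl v : V ⊕ κ) ∉ A))]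
      apply Finset.card_le_card
      intro u hu
      simp only [Finset.mem_map, Finset.mem_filter, Finset.mem_univ, true_and] at hu ⊢
      obtain ⟨u', hu', rfl⟩ := hu
      exact hu'
    have h3 : ((r : ℝ) + 1) * ((Finset.univ.filter (fun u => ¬ (G' c).Adj v u)).card : ℝ) ≤
        ((r : ℝ) + 1) * ((Finset.univ.filter (fun u => ¬ (G c.1).Adj v.1 u)).card : ℝ) := by
      have : ((Finset.univ.filter (fun u => ¬ (G' c).Adj v u)).card : ℝ) ≤
        ((Finset.univ.filter (fun u => ¬ (G c.1).Adj v.1 u)).card : ℝ) := by exact_mod_cast h2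
      gcongr
    refine h3.trans (h1.trans ?_)
    have h4 : (1 - δ / 2) * ((1 - δ / 4) * (Fintype.card V : ℝ)) ≤
        (1 - δ / 2) * Fintype.card V' :=
      mul_le_mul_of_nonneg_left hbig (by linarith)
    refine le_trans ?_ h4
    rw [← mul_assoc]
    apply mul_le_mul_of_nonneg_right _ (by positivity)
    nlinarith) hr
  obtain ⟨T, hT1, hT2, hT3⟩ := full_tiles hval hWW
  set T1 : Multiset (V ⊕ κ) := T.map (Sum.map Subtype.val Subtype.val) with hT1def
  have hT1Cl : T1 ∈ Cl r G := map_Cl Subtype.val Subtype.val (fun c u v h => h) hT1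
  have hT1n : T1.Nodup := hT2.map (Subtype.val_injective.sumMap Subtype.val_injective)
  have hT1c : (lft T1).card = (lft T).card := card_lft_map _ _ _
  have hT0n : (A + T1).Nodup := by
    rw [Multiset.nodup_add]
    refine ⟨hA1, hT1n, ?_⟩
    rw [Multiset.disjoint_left]
    intro a ha hb
    rw [hT1def, Multiset.mem_map] at hb
    obtain ⟨x | x, -, rfl⟩ := hb
    · exact x.2 ha
    · exact x.2 ha
  have hle : A + T1 ≤ (Finset.univ.val : Multiset (V ⊕ κ)) :=
    (Multiset.le_iff_subset hT0n).2 (fun x _ => Finset.mem_univ x)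
  obtain ⟨R, hR⟩ := Multiset.le_iff_exists_add.1 hle
  obtain ⟨kt, hkt1, hkt2⟩ := count_Cl (add_mem hACl hT1Cl)
  have hl : (lft R).card + (r + 1) * kt = (r + 1) * k := by
    have := congrArg (fun X => (lft X).card) hR
    simp only [lft_univ, lft_add (A + T1) R, Multiset.card_add, hkt1] at this
    change (Finset.univ : Finset V).card = _ at this
    rw [Finset.card_univ, hV] at this
    omega
  have hrr : (rgt R).card + (E r).card * kt = (E r).card * k := by
    have := congrArg (fun X => (rgt X).card) hR
    simp only [rgt_univ, rgt_add (A + T1) R, Multiset.card_add, hkt2] at this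
    change (Finset.univ : Finset κ).card = _ at this
    rw [Finset.card_univ, hκ] at this
    omega
  have hktk : kt ≤ k := by
    by_contra hcon
    have : (r + 1) * k < (r + 1) * kt := Nat.mul_lt_mul_of_pos_left (by omega) (by omega)
    omega
  obtain ⟨w, rfl⟩ := Nat.exists_eq_add_of_le hktk
  have hlw : (lft R).card = (r + 1) * w := by rw [mul_add] at hl; omega
  have hrw : (rgt R).card = (E r).card * w := by rw [mul_add] at hrr; omega
  have hwW : w ≤ W := by
    rw [lft_add, Multiset.card_add] at hkt1
    have h1 : (r + 1) * w ≤ W := by rw [mul_add] at hV'; omega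
    nlinarith
  obtain ⟨l, hl1, hl2⟩ := exists_list_tup r w _ _ hlw hrw
  have h9 := hA3 l (by omega)
  rw [hl2, ← lft_rgt R] at h9
  have : (Finset.univ.val : Multiset (V ⊕ κ)) = (A + R) + T1 := by rw [hR]; abel
  rw [this]
  exact add_mem h9 hT1Cl
end Main
end RainbowFactor

namespace RainbowFactor
section Extract
variable {V κ : Type}

lemma list_sum_eq {ι α β : Type} (l : List ι) (s : Finset β) (F : ι → β → α) :
    (l.map (fun t => s.val.map (F t))).sum =
      ((Finset.univ : Finset (Fin l.length)) ×ˢ s).val.map (fun p => F (l.get p.1) p.2) := by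
  rw [← sum_singleton_eq, Finset.sum_product]
  simp only [sum_singleton_eq]
  rw [← List.sum_ofFn]
  congr 1
  conv_lhs => rw [← List.ofFn_get l, List.map_ofFn]
  rfl

lemma enum_of_univ {α β : Type} [Fintype α] (s : Finset β) (h : β → α)
    (hs : (Finset.univ.val : Multiset α) = s.val.map h) :
    Set.InjOn h (s : Set β) ∧ ∀ x, ∃ b ∈ s, h b = x := by
  refine ⟨?_, ?_⟩
  · intro x hx y hy hxy
    refine Multiset.inj_on_of_nodup_map (f := h) (s := s.val) ?_ x hx y hy hxy
    rw [← hs]; exact Finset.univ.nodup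
  · intro x
    have : x ∈ s.val.map h := by rw [← hs]; exact Finset.mem_univ x
    simpa using this

lemma extract [Fintype V] [Fintype κ] [Nonempty κ] {r k : ℕ} {G : κ → SimpleGraph V}
    (hV : Fintype.card V = (r + 1) * k)
    (h : (Finset.univ.val : Multiset (V ⊕ κ)) ∈ Cl r G) :
    ∃ P : Fin k → Finset V,
          (∀ a, (P a).card = r + 1) ∧
          (∀ a b, a ≠ b → Disjoint (P a) (P b)) ∧
          (∀ v : V, ∃ a, v ∈ P a) ∧
          ∃ φ : Sym2 V → κ,
            Set.InjOn φ {e : Sym2 V | ¬ e.IsDiag ∧ ∃ a, ∀ x ∈ e, x ∈ P a} ∧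
            (∀ j, ∃ e : Sym2 V,
              (¬ e.IsDiag ∧ ∃ a, ∀ x ∈ e, x ∈ P a) ∧ φ e = j) ∧
            ∀ u v : V, u ≠ v → (∃ a, u ∈ P a ∧ v ∈ P a) →
              (G (φ s(u, v))).Adj u v := by
  obtain ⟨l, h1, h2, h3⟩ := mem_Cl h
  have hlen : l.length = k := by
    have := congrArg Multiset.card h2
    rw [card_list_sum _ _ (r + 1) (by simp), lft_univ] at this
    change (Finset.univ : Finset V).card = _ at this
    rw [Finset.card_univ, hV] at this
    exact (Nat.eq_of_mul_eq_mul_left (by omega) this).symm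
  subst hlen
  rw [lft_univ, list_sum_eq l _ (fun t => t.1)] at h2
  rw [rgt_univ, list_sum_eq l _ (fun t => t.2)] at h3
  obtain ⟨vi, vs⟩ := enum_of_univ _ _ h2
  obtain ⟨ci, cs⟩ := enum_of_univ _ _ h3
  have hadj : ∀ a : Fin l.length, ∀ p ∈ E r, (G ((l.get a).2 p)).Adj ((l.get a).1 p.1) ((l.get a).1 p.2) :=
    fun a => h1 _ (List.get_mem l a)
  set f : Fin l.length → ℕ → V := fun a => (l.get a).1 with hf
  set g : Fin l.length → ℕ × ℕ → κ := fun a => (l.get a).2 with hg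
  have vi' : ∀ a b i j, i ≤ r → j ≤ r → f a i = f b j → a = b ∧ i = j := by
    intro a b i j hi hj hab
    have := @vi (a, i) (by simp; omega) (b, j) (by simp; omega) hab
    simpa using this
  have ci' : ∀ a b p q, p ∈ E r → q ∈ E r → g a p = g b q → a = b ∧ p = q := by
    intro a b i j hi hj hab
    have := @ci (a, i) (by simpa using hi) (b, j) (by simpa using hj) hab
    rwa [Prod.mk.injEq] at this
  have huniq : ∀ a b p q, p ∈ E r → q ∈ E r → s(f a p.1, f a p.2) = s(f b q.1, f b q.2) →
      a = b ∧ p = q := by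
    intro a b p q hp hq he
    rw [mem_E] at hp hq
    rw [Sym2.eq_iff] at he
    rcases he with ⟨e1, e2⟩ | ⟨e1, e2⟩
    · obtain ⟨x1, x2⟩ := vi' _ _ _ _ (by omega) (by omega) e1
      obtain ⟨y1, y2⟩ := vi' _ _ _ _ (by omega) (by omega) e2
      exact ⟨x1, Prod.ext x2 y2⟩
    · obtain ⟨x1, x2⟩ := vi' _ _ _ _ (by omega) (by omega) e1
      obtain ⟨y1, y2⟩ := vi' _ _ _ _ (by omega) (by omega) e2
      omega
  obtain ⟨φ, hφ⟩ : ∃ φ : Sym2 V → κ, ∀ a, ∀ p ∈ E r, φ s(f a p.1, f a p.2) = g a p := by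
    have : ∀ e : Sym2 V, ∃ c : κ, ∀ a, ∀ p ∈ E r, e = s(f a p.1, f a p.2) → c = g a p := by
      intro e
      by_cases hex : ∃ a, ∃ p ∈ E r, e = s(f a p.1, f a p.2)
      · obtain ⟨a, p, hp, rfl⟩ := hex
        refine ⟨g a p, fun b q hq he => ?_⟩
        obtain ⟨rfl, rfl⟩ := huniq _ _ _ _ hp hq he
        rfl
      · exact ⟨Classical.arbitrary κ, fun a p hp he => (hex ⟨a, p, hp, he⟩).elim⟩
    choose φ hφ using this
    exact ⟨φ, fun a p hp => hφ _ a p hp rfl⟩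
  have hPmem : ∀ a v, v ∈ (Finset.range (r + 1)).image (f a) ↔ ∃ i ≤ r, f a i = v := by
    intro a v
    simp [Nat.lt_succ_iff]
  have hedge : ∀ a u v, u ≠ v → u ∈ (Finset.range (r + 1)).image (f a) →
      v ∈ (Finset.range (r + 1)).image (f a) → ∃ p ∈ E r, s(u, v) = s(f a p.1, f a p.2) := by
    intro a u v huv hu hv
    rw [hPmem] at hu hv
    obtain ⟨i, hi, rfl⟩ := hu
    obtain ⟨j, hj, rfl⟩ := hv
    rcases lt_trichotomy i j with h | h | h
    · exact ⟨(i, j), mem_E.2 ⟨h, hj⟩, rfl⟩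
    · subst h; exact (huv rfl).elim
    · exact ⟨(j, i), mem_E.2 ⟨h, hi⟩, Sym2.eq_swap⟩
  have hedge' : ∀ e : Sym2 V, ¬ e.IsDiag → ∀ a, (∀ x ∈ e, x ∈ (Finset.range (r + 1)).image (f a)) →
      ∃ p ∈ E r, e = s(f a p.1, f a p.2) := by
    intro e
    induction e using Sym2.ind with
    | _ u v =>
      intro hd a ha
      exact hedge a u v (by simpa using hd) (ha u (by simp)) (ha v (by simp))
  refine ⟨fun a => (Finset.range (r + 1)).image (f a), ?_, ?_, ?_, φ, ?_, ?_, ?_⟩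
  · intro a
    rw [Finset.card_image_of_injOn, Finset.card_range]
    intro i hi j hj hij
    simp only [Finset.coe_range, Set.mem_Iio] at hi hj
    exact (vi' a a i j (by omega) (by omega) hij).2
  · intro a b hab
    rw [Finset.disjoint_left]
    intro v hv hv'
    rw [hPmem] at hv hv'
    obtain ⟨i, hi, rfl⟩ := hv
    obtain ⟨j, hj, hji⟩ := hv'
    exact hab (vi' _ _ _ _ hj hi hji).1.symm
  · intro v
    obtain ⟨⟨a, i⟩, hb, rfl⟩ := vs v
    refine ⟨a, ?_⟩
    rw [hPmem]
    simp at hb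
    exact ⟨i, by omega, rfl⟩
  · rintro e ⟨he1, a, he2⟩ e' ⟨he1', b, he2'⟩ hee
    obtain ⟨p, hp, rfl⟩ := hedge' e he1 a he2
    obtain ⟨q, hq, rfl⟩ := hedge' e' he1' b he2'
    rw [hφ _ _ hp, hφ _ _ hq] at hee
    obtain ⟨rfl, rfl⟩ := ci' _ _ _ _ hp hq hee
    rfl
  · intro j
    obtain ⟨⟨a, p⟩, hb, rfl⟩ := cs j
    have hp : p ∈ E r := by simpa using hb
    have hp' := mem_E.1 hp
    refine ⟨s(f a p.1, f a p.2), ⟨?_, a, ?_⟩, hφ a p hp⟩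
    · rw [Sym2.mk_isDiag_iff]
      intro h
      have := (vi' _ _ _ _ (by omega) (by omega) h).2
      omega
    · intro x hx
      rw [hPmem]
      rcases Sym2.mem_iff.1 hx with rfl | rfl
      · exact ⟨p.1, by omega, rfl⟩
      · exact ⟨p.2, by omega, rfl⟩
  · rintro u v huv ⟨a, hu, hv⟩
    obtain ⟨p, hp, he⟩ := hedge a u v huv hu hv
    rw [he, hφ a p hp]
    have h := hadj a p hp
    rcases Sym2.eq_iff.1 he with ⟨rfl, rfl⟩ | ⟨rfl, rfl⟩
    · exact h
    · exact h.symm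
end Extract
end RainbowFactor

/-- Theorem 5.3 (thm:factor_rb, Theorem 1.3 in Montgomery–Müyesser–Pehova): a transversal
`K_{r+1}`-factor in graph collections of minimum degree `(r/(r+1) + α)n`. -/
theorem stmt_12 (r : ℕ) (hr : 1 ≤ r) (α : ℝ) (hα : 0 < α) :
    ∃ n₀ : ℕ, ∀ n : ℕ, n₀ ≤ n → (r + 1) ∣ n →
      ∀ G : Fin ((r + 1).choose 2 * (n / (r + 1))) → SimpleGraph (Fin n),
        (∀ j, ∀ v : Fin n,
          ((r : ℝ) / (r + 1) + α) * n ≤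
            ((Finset.univ.filter (fun u => (G j).Adj v u)).card : ℝ)) →
        ∃ P : Fin (n / (r + 1)) → Finset (Fin n),
          (∀ a, (P a).card = r + 1) ∧
          (∀ a b, a ≠ b → Disjoint (P a) (P b)) ∧
          (∀ v : Fin n, ∃ a, v ∈ P a) ∧
          ∃ φ : Sym2 (Fin n) → Fin ((r + 1).choose 2 * (n / (r + 1))),
            Set.InjOn φ {e : Sym2 (Fin n) | ¬ e.IsDiag ∧ ∃ a, ∀ x ∈ e, x ∈ P a} ∧
            (∀ j, ∃ e : Sym2 (Fin n),
              (¬ e.IsDiag ∧ ∃ a, ∀ x ∈ e, x ∈ P a) ∧ φ e = j) ∧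
            ∀ u v : Fin n, u ≠ v → (∃ a, u ∈ P a ∧ v ∈ P a) →
              (G (φ s(u, v))).Adj u v := by
  set δ : ℝ := min (((r : ℝ) + 1) * α) 1 with hδ
  have hδ0 : 0 < δ := lt_min (by positivity) one_pos
  obtain ⟨n0, hn0⟩ := RainbowFactor.main r hr δ hδ0 (min_le_right _ _)
  refine ⟨max n0 1, ?_⟩
  intro n hn hdvd G hG
  have hnk : n = (r + 1) * (n / (r + 1)) := (Nat.mul_div_cancel' hdvd).symm
  have hn1 : 1 ≤ n := (le_max_right _ _).trans hn
  have hkpos : 0 < n / (r + 1) := Nat.div_pos (Nat.le_of_dvd hn1 hdvd) (by omega)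
  have hcpos : 0 < (r + 1).choose 2 := Nat.choose_pos (by omega)
  have : Nonempty (Fin ((r + 1).choose 2 * (n / (r + 1)))) := ⟨⟨0, by positivity⟩⟩
  have hcV : Fintype.card (Fin n) = (r + 1) * (n / (r + 1)) := by
    rw [Fintype.card_fin]; exact hnk
  refine RainbowFactor.extract hcV (hn0 _ _ G (n / (r + 1)) ?_ hcV ?_ ?_)
  · rw [Fintype.card_fin]; exact (le_max_left _ _).trans hn
  · rw [Fintype.card_fin, RainbowFactor.card_E]
  · intro c v
    have h1 := hG c v
    have h2 := Finset.card_filter_add_card_filter_not (s := (Finset.univ : Finset (Fin n)))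
      (fun u => (G c).Adj v u)
    rw [Finset.card_univ, Fintype.card_fin] at h2
    have h3 : ((Finset.univ.filter (fun u => (G c).Adj v u)).card : ℝ) +
      ((Finset.univ.filter (fun u => ¬ (G c).Adj v u)).card : ℝ) = n := by exact_mod_cast h2
    rw [Fintype.card_fin]
    have h4 : ((r : ℝ) + 1) * (((r : ℝ) / (r + 1) + α) * n) = (r + (r + 1) * α) * n := by
      field_simp
    have h5 : ((r : ℝ) + 1) * (((r : ℝ) / (r + 1) + α) * n) ≤
        ((r : ℝ) + 1) * ((Finset.univ.filter (fun u => (G c).Adj v u)).card : ℝ) :=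
      mul_le_mul_of_nonneg_left h1 (by positivity)
    have h6 : δ * n ≤ ((r + 1) * α) * n :=
      mul_le_mul_of_nonneg_right (min_le_left _ _) (by positivity)
    have h7 : ((r : ℝ) + 1) * ((Finset.univ.filter (fun u => ¬ (G c).Adj v u)).card : ℝ) =
        (r + 1) * n - (r + 1) * ((Finset.univ.filter (fun u => (G c).Adj v u)).card : ℝ) := by
      rw [← h3]; ring
    rw [h7]
    linarith
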